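/- arXiv:1810.00065 — 2 statements merged into one kernel-verified Lean document; each statement's English description precedes it below -/
import Mathlib

section
/- If g is a good counter on a ternary graph G, then |g(∅,∅)| ≤ 1. -/
open Finset
open scoped Classical

variable {V : Type*} [Fintype V]

/-- `fG G X Y` is the sum of `(-1)^|A|` over stable sets `A` of `G`
with `X ⊆ A` and `A ∩ Y = ∅`. -/
noncomputable def fG (G : SimpleGraph V) (X Y : Finset V) : ℤ :=
  ∑ A ∈ Finset.univ.filter (fun A : Finset V =>
      (∀ u ∈ A, ∀ v ∈ A, ¬ G.Adj u v) ∧ X ⊆ A ∧ Disjoint A Y),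
    (-1 : ℤ) ^ A.card

/-- `g` is a counter on `G` if `g = fG G` or `g = - fG G`. -/
def IsCounter (G : SimpleGraph V) (g : Finset V → Finset V → ℤ) : Prop :=
  (g = fun X Y => fG G X Y) ∨ (g = fun X Y => - fG G X Y)

/-- A counter is good if it satisfies the two boundedness conditions. -/
def IsGood (g : Finset V → Finset V → ℤ) : Prop :=
  ∀ X Y : Finset V, Disjoint X Y → (X ∪ Y).Nonempty →
    |g X Y| ≤ 1 ∧
    ∀ u v : V, u ∉ X ∪ Y → v ∉ X ∪ Y →
      |g (insert u X) Y - g (insert v X) Y| ≤ 1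
/-- A graph is ternary if it has no induced cycle of length divisible by three. -/
def Ternary (G : SimpleGraph V) : Prop :=
  ∀ n : ℕ, 3 ≤ n → 3 ∣ n → IsEmpty (SimpleGraph.cycleGraph n ↪g G)

set_option linter.unusedSectionVars false

/-! ### General properties of counters -/

theorem fG_split (G : SimpleGraph V) (X Y : Finset V) (a : V) :
    fG G X Y = fG G (insert a X) Y + fG G X (insert a Y) := by
  unfold fG
  rw [← Finset.sum_filter_add_sum_filter_not _ (fun A : Finset V => a ∈ A)]
  congr 1
  · rw [Finset.filter_filter]
    refine Finset.sum_congr (Finset.filter_congr fun A _ => ?_) fun _ _ => rfl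
    rw [Finset.insert_subset_iff]
    tauto
  · rw [Finset.filter_filter]
    refine Finset.sum_congr (Finset.filter_congr fun A _ => ?_) fun _ _ => rfl
    rw [Finset.disjoint_insert_right]
    tauto

theorem fG_eq_zero_of_adj (G : SimpleGraph V) {X : Finset V} (Y : Finset V) {u v : V}
    (hu : u ∈ X) (hv : v ∈ X) (h : G.Adj u v) : fG G X Y = 0 := by
  unfold fG
  rw [Finset.filter_false_of_mem, Finset.sum_empty]
  rintro A - ⟨hA, hX, -⟩
  exact hA u (hX hu) v (hX hv) h

theorem fG_eq_zero_of_isolated (G : SimpleGraph V) {X Y : Finset V} {a : V}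
    (haX : a ∉ X) (haY : a ∉ Y) (hN : ∀ v, G.Adj a v → v ∈ Y) : fG G X Y = 0 := by
  unfold fG
  refine Finset.sum_involution
    (fun A _ => if a ∈ A then A.erase a else insert a A) ?_ ?_ ?_ ?_
  · intro A _
    by_cases ha : a ∈ A
    · have := Finset.card_erase_add_one ha
      simp only [ha, if_true]
      rw [← this, pow_succ]
      ring
    · simp only [ha, if_false]
      rw [Finset.card_insert_of_notMem ha, pow_succ]
      ring
  · intro A _ _ h
    by_cases ha : a ∈ A
    · simp only [ha, if_true] at h
      exact Finset.erase_eq_self.1 h ha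
    · simp only [ha, if_false] at h
      exact ha (Finset.insert_eq_self.1 h)
  · intro A hA
    simp only [Finset.mem_filter, Finset.mem_univ, true_and] at hA ⊢
    obtain ⟨hs, hX, hY⟩ := hA
    by_cases ha : a ∈ A
    · simp only [ha, if_true]
      refine ⟨fun u hu v hv => hs u (Finset.mem_of_mem_erase hu) v (Finset.mem_of_mem_erase hv),
        fun w hw => Finset.mem_erase.2 ⟨fun h => haX (h ▸ hw), hX hw⟩,
        hY.mono_left (Finset.erase_subset a A)⟩
    · simp only [ha, if_false]
      refine ⟨?_, hX.trans (Finset.subset_insert a A), Finset.disjoint_insert_left.2 ⟨haY, hY⟩⟩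
      have key : ∀ v ∈ A, ¬ G.Adj a v := fun v hv h =>
        Finset.disjoint_left.1 hY hv (hN v h)
      intro u hu v hv h
      rcases Finset.mem_insert.1 hu with hu' | hu'
      · subst hu'
        rcases Finset.mem_insert.1 hv with hv' | hv'
        · exact h.ne hv'.symm
        · exact key v hv' h
      · rcases Finset.mem_insert.1 hv with hv' | hv'
        · subst hv'
          exact key u hu' h.symm
        · exact hs u hu' v hv' h
  · intro A _
    by_cases ha : a ∈ A
    · simp [ha]
    · simp [ha]

namespace IsCounter

variable {G : SimpleGraph V} {g : Finset V → Finset V → ℤ}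

theorem split (hc : IsCounter G g) (X Y : Finset V) (a : V) :
    g X Y = g (insert a X) Y + g X (insert a Y) := by
  rcases hc with rfl | rfl
  · exact fG_split G X Y a
  · have := fG_split G X Y a
    dsimp only
    linarith

theorem eq_zero_of_adj (hc : IsCounter G g) {X : Finset V} (Y : Finset V) {u v : V}
    (hu : u ∈ X) (hv : v ∈ X) (h : G.Adj u v) : g X Y = 0 := by
  rcases hc with rfl | rfl <;> simp [fG_eq_zero_of_adj G Y hu hv h]

theorem eq_zero_of_isolated (hc : IsCounter G g) {X Y : Finset V} {a : V}
    (haX : a ∉ X) (haY : a ∉ Y) (hN : ∀ v, G.Adj a v → v ∈ Y) : g X Y = 0 := by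
  rcases hc with rfl | rfl <;> simp [fG_eq_zero_of_isolated G haX haY hN]

theorem neg (hc : IsCounter G g) : IsCounter G (fun X Y => - g X Y) := by
  rcases hc with rfl | rfl
  · exact Or.inr rfl
  · exact Or.inl (by simp)

/-- Neighbours of a chosen vertex may be excluded for free. -/
theorem union_of_adj (hc : IsCounter G g) {X Z : Finset V} (Y : Finset V) {a : V}
    (ha : a ∈ X) (hZ : ∀ z ∈ Z, G.Adj a z) : g X (Y ∪ Z) = g X Y := by
  induction Z using Finset.induction_on with
  | empty => simp
  | insert z Z _ ih =>
    rw [Finset.union_insert, ← ih fun w hw => hZ w (Finset.mem_insert_of_mem hw),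
      hc.split X (Y ∪ Z) z, hc.eq_zero_of_adj (Y ∪ Z) (Finset.mem_insert_of_mem ha)
        (Finset.mem_insert_self z X) (hZ z (Finset.mem_insert_self z Z)), zero_add]

theorem insert_of_adj (hc : IsCounter G g) {X : Finset V} (Y : Finset V) {a z : V}
    (ha : a ∈ X) (hz : G.Adj a z) : g X (insert z Y) = g X Y := by
  rw [hc.split X Y z, hc.eq_zero_of_adj Y (Finset.mem_insert_of_mem ha)
    (Finset.mem_insert_self z X) hz, zero_add]

end IsCounter

namespace IsGood

variable {G : SimpleGraph V} {g : Finset V → Finset V → ℤ}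

theorem neg (hg : IsGood g) : IsGood (fun X Y => - g X Y) := by
  intro X Y hd hne
  obtain ⟨h1, h2⟩ := hg X Y hd hne
  refine ⟨by rwa [abs_neg], fun u v hu hv => ?_⟩
  have := h2 v u hv hu
  rwa [show - g (insert u X) Y - - g (insert v X) Y = g (insert v X) Y - g (insert u X) Y by ring]

theorem bound (hg : IsGood g) {X Y : Finset V} (hd : Disjoint X Y) (hne : (X ∪ Y).Nonempty) :
    -1 ≤ g X Y ∧ g X Y ≤ 1 :=
  abs_le.1 (hg X Y hd hne).1

theorem diff (hg : IsGood g) {X Y : Finset V} (hd : Disjoint X Y) (hne : (X ∪ Y).Nonempty)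
    {u v : V} (huX : u ∉ X) (huY : u ∉ Y) (hvX : v ∉ X) (hvY : v ∉ Y) :
    g (insert u X) Y ≤ g (insert v X) Y + 1 := by
  have := (abs_le.1 ((hg X Y hd hne).2 u v (by simp [huX, huY]) (by simp [hvX, hvY]))).2
  linarith

theorem eq_one_of_pair (hg : IsGood g) (hc : IsCounter G g) {X Y : Finset V} {a b : V}
    (hd : Disjoint X Y) (hne : (X ∪ Y).Nonempty) (hab : a ≠ b)
    (haX : a ∉ X) (haY : a ∉ Y) (hbX : b ∉ X) (hbY : b ∉ Y)
    (h : g X Y = 1) (ha : g (insert a X) Y = 1) (hb : g (insert b (insert a X)) Y = 1) :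
    g (insert b X) Y = 1 := by
  by_contra hcon
  have hb0 : g (insert b X) Y = 0 := by
    have h1 := hg.bound (X := X) (Y := insert b Y) (by simp [hbX, hd])
      (hne.mono (Finset.union_subset_union_right (Finset.subset_insert b Y)))
    have h2 := hg.bound (X := insert b X) (Y := Y) (by simp [hbY, hd])
      (hne.mono (Finset.union_subset_union_left (Finset.subset_insert b X)))
    have h3 := hc.split X Y b
    omega
  have key : ∀ Z : Finset V, (∀ z ∈ Z, G.Adj a z) →
      g X (Y ∪ Z) = 1 ∧ g (insert b X) (Y ∪ Z) = 0 := by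
    intro Z
    induction Z using Finset.induction_on with
    | empty => simp [h, hb0]
    | insert z Z hzZ ih =>
      intro hZ
      have haz : G.Adj a z := hZ z (Finset.mem_insert_self z Z)
      have hZ' : ∀ w ∈ Z, G.Adj a w := fun w hw => hZ w (Finset.mem_insert_of_mem hw)
      obtain ⟨i1, i2⟩ := ih hZ'
      rw [Finset.union_insert]
      by_cases hzY : z ∈ Y
      · rw [Finset.insert_eq_of_mem (Finset.mem_union_left Z hzY)]
        exact ⟨i1, i2⟩
      have hNX : ∀ w, G.Adj a w → w ∉ X := by
        intro w hw hwX
        have := hc.eq_zero_of_adj Y (Finset.mem_insert_self a X) (Finset.mem_insert_of_mem hwX) hw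
        omega
      have hNb : ¬ G.Adj a b := by
        intro hw
        have := hc.eq_zero_of_adj Y (Finset.mem_insert_of_mem (Finset.mem_insert_self a X))
          (Finset.mem_insert_self b _) hw
        omega
      have hza : z ≠ a := haz.ne'
      have hzb : z ≠ b := by rintro rfl; exact hNb haz
      have haZ : a ∉ Z := fun hw => G.loopless.irrefl _ (hZ' a hw)
      have hbZ : b ∉ Z := fun hw => hNb (hZ' b hw)
      have hXZ : Disjoint X Z := Finset.disjoint_left.2 fun w hw hwZ => hNX w (hZ' w hwZ) hw
      have hzX := hNX z haz
      have e1 : g (insert a X) (Y ∪ Z) = 1 := by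
        rw [hc.union_of_adj Y (Finset.mem_insert_self a X) hZ', ha]
      have e2 : g (insert b (insert a X)) (Y ∪ Z) = 1 := by
        rw [hc.union_of_adj Y (Finset.mem_insert_of_mem (Finset.mem_insert_self a X)) hZ', hb]
      have e3 : g (insert z (insert a X)) (Y ∪ Z) = 0 :=
        hc.eq_zero_of_adj _ (Finset.mem_insert_of_mem (Finset.mem_insert_self a X))
          (Finset.mem_insert_self z _) haz
      have hne' : (X ∪ (Y ∪ Z)).Nonempty := by
        rw [← Finset.union_assoc]; exact hne.mono Finset.subset_union_left
      have hd' : Disjoint X (Y ∪ Z) := Finset.disjoint_union_right.2 ⟨hd, hXZ⟩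
      have s1 := hc.split X (Y ∪ Z) a
      have s2 := hc.split (insert b X) (Y ∪ Z) a
      have s3 := hc.split (insert z X) (Y ∪ Z) a
      have s4 := hc.split X (Y ∪ Z) z
      have s5 := hc.split (insert b X) (Y ∪ Z) z
      have s6 := hc.split X (insert z (Y ∪ Z)) b
      rw [Finset.insert_comm] at s2 s3
      have d1 := hg.diff (X := X) (Y := insert a (Y ∪ Z)) (by simp [haX, hd, hXZ])
        (by simp) (u := z) (v := b) hzX (by simp [hza, hzY, hzZ]) hbX
        (by simp [hab.symm, hbY, hbZ])
      have d2 := hg.diff (X := insert b X) (Y := Y ∪ Z) (by simp [hbY, hbZ, hd, hXZ])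
        (by simp) (u := a) (v := z) (by simp [hab, haX]) (by simp [haY, haZ])
        (by simp [hzb, hzX]) (by simp [hzY, hzZ])
      rw [Finset.insert_comm a b X] at d2
      have b1 := hg.bound (X := X) (Y := insert z (Y ∪ Z)) (by simp [hzX, hd, hXZ]) (by simp)
      have b2 := hg.bound (X := X) (Y := insert b (insert z (Y ∪ Z)))
        (by simp [hbX, hzX, hd, hXZ]) (by simp)
      omega
  have h0 := (key (univ.filter (G.Adj a)) (by simp)).1
  rw [hc.eq_zero_of_isolated haX (a := a) (by simp [haY])
    (fun v hv => by simp [hv])] at h0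
  omega

end IsGood

/-! ### Counters with value two at the empty pair -/

/-- A good counter taking the value two at the empty pair. -/
structure IsExtremal (G : SimpleGraph V) (g : Finset V → Finset V → ℤ) : Prop where
  counter : IsCounter G g
  good : IsGood g
  eq_two : g ∅ ∅ = 2

namespace IsExtremal

variable {G : SimpleGraph V} {g : Finset V → Finset V → ℤ}

theorem singleton_aux (h : IsExtremal G g) (v : V) : g {v} ∅ = 1 ∧ g ∅ {v} = 1 := by
  have s := h.counter.split ∅ ∅ v
  have b1 := h.good.bound (X := {v}) (Y := ∅) (by simp) (by simp)
  have b2 := h.good.bound (X := ∅) (Y := {v}) (by simp) (by simp)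
  have := h.eq_two
  simp only [insert_empty_eq] at s
  omega

theorem singleton_left (h : IsExtremal G g) (v : V) : g {v} ∅ = 1 := (h.singleton_aux v).1

theorem singleton_right (h : IsExtremal G g) (v : V) : g ∅ {v} = 1 := (h.singleton_aux v).2

theorem left_right (h : IsExtremal G g) (u v : V) : g {u} {v} = 1 - g {u, v} ∅ := by
  have s := h.counter.split {u} ∅ v
  rw [h.singleton_left, Finset.pair_comm] at s
  simp only [insert_empty_eq] at s
  omega

theorem pair_right (h : IsExtremal G g) (u v : V) : g ∅ {u, v} = g {u, v} ∅ := by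
  have s := h.counter.split ∅ {v} u
  rw [h.singleton_right] at s
  have := h.left_right u v
  simp only [insert_empty_eq] at s
  omega

theorem pair_eq (h : IsExtremal G g) {u v : V} (huv : u ≠ v) :
    g {u, v} ∅ = 0 ∨ g {u, v} ∅ = 1 := by
  have b1 := h.good.bound (X := {u}) (Y := {v}) (by simp [huv]) (by simp)
  have b2 := h.good.bound (X := {u, v}) (Y := ∅) (by simp) (by simp)
  have := h.left_right u v
  omega

theorem pair_eq_zero (h : IsExtremal G g) {u v : V} (huv : G.Adj u v) : g {u, v} ∅ = 0 :=
  h.counter.eq_zero_of_adj ∅ (by simp) (by simp) huv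

theorem pair_trans (h : IsExtremal G g) {u v w : V} (huv : u ≠ v) (huw : u ≠ w) (hvw : v ≠ w)
    (h1 : g {u, v} ∅ = 1) (h2 : g {u, w} ∅ = 1) : g {v, w} ∅ = 1 := by
  by_contra hcon
  have h3 : g {v, w} ∅ = 0 := (h.pair_eq hvw).resolve_right hcon
  have s1 := h.counter.split {u, v} ∅ w
  simp only [insert_empty_eq] at s1
  have b1 := h.good.bound (X := {u, v}) (Y := {w}) (by simp [huw.symm, hvw.symm]) (by simp)
  have b2 := h.good.bound (X := {w, u, v}) (Y := ∅) (by simp) (by simp)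
  rcases (by omega : g {w, u, v} ∅ = 1 ∨ g {w, u, v} ∅ = 0) with ht | ht
  · have := h.good.eq_one_of_pair h.counter (X := {v}) (Y := ∅) (a := u) (b := w) (by simp)
      (by simp) huw (by simp [huv]) (by simp) (by simp [hvw.symm]) (by simp)
      (h.singleton_left v) h1 ht
    rw [Finset.pair_comm] at this
    omega
  · have e1 : g {v} {w} = 1 := by rw [h.left_right, h3]; rfl
    have e2 : g {u} {w} = 0 := by rw [h.left_right, h2]; rfl
    have := h.good.eq_one_of_pair h.counter (X := ∅) (Y := {w}) (a := v) (b := u) (by simp)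
      (by simp) huv.symm (by simp) (by simp [hvw]) (by simp) (by simp [huw])
      (h.singleton_right w) e1 (by simp only [insert_empty_eq]; omega)
    simp only [insert_empty_eq] at this
    omega

/-- Among sets of neighbours of `v`, the value `g ∅ Y` is zero or one. -/
theorem right_eq (h : IsExtremal G g) {v : V} {Y : Finset V} (hY : ∀ y ∈ Y, G.Adj v y)
    (hne : Y.Nonempty) : g ∅ Y = 0 ∨ g ∅ Y = 1 := by
  have s := h.counter.split ∅ Y v
  have e := h.counter.union_of_adj (X := {v}) ∅ (by simp) hY
  rw [Finset.empty_union, h.singleton_left] at e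
  have b1 := h.good.bound (X := ∅) (Y := Y) (by simp) (by simpa)
  have b2 := h.good.bound (X := ∅) (Y := insert v Y) (by simp) (by simp)
  simp only [insert_empty_eq] at s
  omega

theorem right_neighbors (h : IsExtremal G g) (v : V) : g ∅ (univ.filter (G.Adj v)) = 0 :=
  h.counter.eq_zero_of_isolated (a := v) (by simp) (by simp) (by simp)

theorem neighbors_nonempty (h : IsExtremal G g) (v : V) : (univ.filter (G.Adj v)).Nonempty := by
  rw [Finset.nonempty_iff_ne_empty]
  intro h0
  have h1 := h.right_neighbors v
  rw [h0, h.eq_two] at h1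
  omega

theorem exists_critical (h : IsExtremal G g) (x : V) : ∃ (Q : Finset V) (c : V),
    (∀ q ∈ Q, G.Adj x q) ∧ G.Adj x c ∧ c ∉ Q ∧ Q.Nonempty ∧ g ∅ Q = 1 ∧ g ∅ (insert c Q) = 0 := by
  by_contra! hcon
  have key : ∀ Z : Finset V, (∀ z ∈ Z, G.Adj x z) → Z.Nonempty → g ∅ Z = 1 := by
    intro Z
    induction Z using Finset.induction_on with
    | empty => simp
    | insert z Z hz ih =>
      intro hZ _
      rcases Z.eq_empty_or_nonempty with rfl | hne
      · simpa using h.singleton_right z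
      have hZ' : ∀ w ∈ Z, G.Adj x w := fun w hw => hZ w (Finset.mem_insert_of_mem hw)
      exact (h.right_eq hZ (by simp)).resolve_left
        (hcon Z z hZ' (hZ z (by simp)) hz hne (ih hZ' hne))
  have := key _ (by simp) (h.neighbors_nonempty x)
  rw [h.right_neighbors] at this
  omega

/-- If every two neighbours of `x` agree, then some neighbour `c` of `x` has the property that
excluding neighbours of `c` makes the value independent of `x`. -/
theorem exists_cone (h : IsExtremal G g) {x : V}
    (hx : ∀ y z, G.Adj x y → G.Adj x z → y ≠ z → g {y, z} ∅ = 1) :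
    ∃ c, G.Adj x c ∧ ∀ P : Finset V, (∀ p ∈ P, G.Adj c p) → x ∉ P → P.Nonempty →
      g {x} P = 0 := by
  have hc := h.counter
  obtain ⟨Q, c, hQ, hxc, hcQ, ⟨b, hbQ⟩, hQ1, hQ0⟩ := h.exists_critical x
  refine ⟨c, hxc, fun P hP hxP hne => ?_⟩
  have hxb := hQ b hbQ
  have hbc : b ≠ c := by rintro rfl; exact hcQ hbQ
  have hcb1 := hx b c hxb hxc hbc
  have hcP : c ∉ P := fun hw => G.loopless.irrefl _ (hP c hw)
  have hbP : b ∉ P := by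
    intro hw
    have := h.pair_eq_zero (hP b hw).symm
    omega
  have gcQ : g {c} Q = 1 := by
    have s := hc.split ∅ Q c
    simp only [insert_empty_eq] at s
    omega
  have gcP : g {c} P = 1 := by
    have := hc.union_of_adj (X := {c}) ∅ (by simp) hP
    rwa [Finset.empty_union, h.singleton_left] at this
  have hPx : ∀ p ∈ insert x P, G.Adj c p := by
    intro p hp
    rcases Finset.mem_insert.1 hp with rfl | hp
    · exact hxc.symm
    · exact hP p hp
  have s1 := hc.split ∅ P x
  simp only [insert_empty_eq] at s1
  by_contra hcon
  have hxP1 : g ∅ P = 1 ∧ g {x} P = 1 := by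
    have hPx' := h.right_eq hPx (by simp)
    rcases h.right_eq hP hne with h0 | h1
    · have d := h.good.diff (X := ∅) (Y := P) (by simp) (by simpa) (u := c) (v := x)
        (by simp) hcP (by simp) hxP
      simp only [insert_empty_eq] at d
      omega
    · omega
  obtain ⟨hP1, gxP⟩ := hxP1
  have gbP : g {b} P = 1 := by
    have e : g {b, c} P = 1 := by
      have := hc.union_of_adj (X := {b, c}) ∅ (a := c) (by simp) hP
      rwa [Finset.empty_union, hcb1] at this
    have := h.good.eq_one_of_pair hc (X := ∅) (Y := P) (a := c) (b := b) (by simp) (by simpa)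
      hbc.symm (by simp) hcP (by simp) hbP hP1 (by simpa using gcP) (by simpa using e)
    simpa using this
  have hstay : ∀ Z : Finset V, (∀ z ∈ Z, G.Adj x z) → g ∅ (insert b P ∪ Z) = 0 := by
    intro Z
    induction Z using Finset.induction_on with
    | empty =>
      have s := hc.split ∅ P b
      simp only [insert_empty_eq] at s
      rw [Finset.union_empty]
      omega
    | insert z Z hz ih =>
      intro hZ
      have hxz := hZ z (by simp)
      have hZ' : ∀ w ∈ Z, G.Adj x w := fun w hw => hZ w (Finset.mem_insert_of_mem hw)
      have i := ih hZ'
      rw [Finset.union_insert]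
      by_cases hzY : z ∈ insert b P ∪ Z
      · rwa [Finset.insert_eq_of_mem hzY]
      have hxY : x ∉ insert b P ∪ Z := by
        simp only [Finset.mem_union, Finset.mem_insert, not_or]
        exact ⟨⟨hxb.ne, hxP⟩, fun hw => G.loopless.irrefl _ (hZ' x hw)⟩
      have gx : g {x} (insert b P ∪ Z) = 1 := by
        rw [hc.union_of_adj _ (a := x) (by simp) hZ', hc.insert_of_adj _ (a := x) (by simp) hxb,
          gxP]
      have gx' : g {x} (insert z (insert b P ∪ Z)) = 1 := by
        rw [hc.insert_of_adj _ (a := x) (by simp) hxz, gx]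
      have d := h.good.diff (X := ∅) (Y := insert b P ∪ Z) (by simp) (by simp) (u := x) (v := z)
        (by simp) hxY (by simp) hzY
      have s := hc.split ∅ (insert b P ∪ Z) z
      have s' := hc.split ∅ (insert z (insert b P ∪ Z)) x
      have b1 := h.good.bound (X := ∅) (Y := insert x (insert z (insert b P ∪ Z)))
        (by simp) (by simp)
      simp only [insert_empty_eq] at d s s'
      omega
  have t0 : g ∅ (P ∪ Q) = 0 := by
    have := hstay Q hQ
    rwa [Finset.insert_union, Finset.insert_eq_of_mem (Finset.mem_union_right P hbQ)] at this
  have t1 : g {c} (P ∪ Q) = 1 := by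
    rw [Finset.union_comm, hc.union_of_adj Q (a := c) (by simp) hP, gcQ]
  have t2 : g {x} (insert c (P ∪ Q)) = 1 := by
    rw [hc.insert_of_adj _ (a := x) (by simp) hxc, hc.union_of_adj P (a := x) (by simp) hQ, gxP]
  have s2 := hc.split ∅ (P ∪ Q) c
  have s3 := hc.split ∅ (insert c (P ∪ Q)) x
  have b1 := h.good.bound (X := ∅) (Y := insert x (insert c (P ∪ Q))) (by simp) (by simp)
  simp only [insert_empty_eq] at s2 s3
  omega

/-- If all nonempty `X ⊆ N` have `g X ∅ = 1`, then also `g ∅ N = 1`. -/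
theorem right_eq_one (h : IsExtremal G g) {N : Finset V} (hne : N.Nonempty)
    (hN : ∀ X ⊆ N, X.Nonempty → g X ∅ = 1) : g ∅ N = 1 := by
  have mixed : ∀ Y ⊆ N, Y.Nonempty → ∀ X ⊆ N, X.Nonempty → g X Y = 0 := by
    intro Y
    induction Y using Finset.induction_on with
    | empty => simp
    | insert y Y _ ih =>
      intro hY _ X hX hX0
      have hy : y ∈ N := hY (by simp)
      have s := h.counter.split X Y y
      have hX' : insert y X ⊆ N := Finset.insert_subset hy hX
      rcases Y.eq_empty_or_nonempty with rfl | hY0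
      · rw [hN X hX hX0, hN _ hX' (by simp)] at s
        omega
      · have hY' : Y ⊆ N := (Finset.subset_insert y Y).trans hY
        rw [ih hY' hY0 X hX hX0, ih hY' hY0 _ hX' (by simp)] at s
        omega
  have key : ∀ Y ⊆ N, Y.Nonempty → g ∅ Y = 1 := by
    intro Y
    induction Y using Finset.induction_on with
    | empty => simp
    | insert y Y _ ih =>
      intro hY _
      rcases Y.eq_empty_or_nonempty with rfl | hY0
      · simpa using h.singleton_right y
      · have hY' : Y ⊆ N := (Finset.subset_insert y Y).trans hY
        have s := h.counter.split ∅ Y y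
        have m := mixed Y hY' hY0 {y} (by simpa using hY (Finset.mem_insert_self y Y)) (by simp)
        rw [ih hY' hY0, insert_empty_eq, m] at s
        omega
  exact key N subset_rfl hne

theorem exists_neighbors (h : IsExtremal G g) (x : V) :
    ∃ y z, G.Adj x y ∧ G.Adj x z ∧ y ≠ z ∧ g {y, z} ∅ = 0 := by
  by_contra! hcon
  have hc := h.counter
  obtain ⟨c, hxc, hcone⟩ := h.exists_cone
    fun y z hy hz hyz => (h.pair_eq hyz).resolve_left (hcon y z hy hz hyz)
  set N := (univ.filter (G.Adj c)).erase x with hNdef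
  have hNx : insert x N = univ.filter (G.Adj c) := Finset.insert_erase (by simp [hxc.symm])
  have hxN : x ∉ N := Finset.notMem_erase x _
  have hNc : ∀ p ∈ N, G.Adj c p := fun p hp => by
    simpa using Finset.mem_of_mem_erase hp
  have hF := h.right_neighbors c
  rw [← hNx] at hF
  have hne : N.Nonempty := by
    rw [Finset.nonempty_iff_ne_empty]
    intro h0
    rw [h0, insert_empty_eq, h.singleton_right] at hF
    omega
  have hx0 : ∀ X ⊆ N, ∀ Y ⊆ N, Y.Nonempty → g (insert x X) Y = 0 := by
    intro X
    induction X using Finset.induction_on with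
    | empty =>
      intro _ Y hY hY0
      exact hcone Y (fun p hp => hNc p (hY hp)) (fun hw => hxN (hY hw)) hY0
    | insert a X _ ih =>
      intro hX Y hY hY0
      have hX' : X ⊆ N := (Finset.subset_insert a X).trans hX
      have s := hc.split (insert x X) Y a
      rw [ih hX' Y hY hY0,
        ih hX' _ (Finset.insert_subset (hX (Finset.mem_insert_self a X)) hY) (by simp),
        Finset.insert_comm] at s
      omega
  have hx1 : ∀ X ⊆ N, g (insert x X) ∅ = 1 := by
    intro X
    induction X using Finset.induction_on with
    | empty => simpa using h.singleton_left x
    | insert a X _ ih =>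
      intro hX
      have hX' : X ⊆ N := (Finset.subset_insert a X).trans hX
      have s := hc.split (insert x X) ∅ a
      rw [ih hX', insert_empty_eq,
        hx0 X hX' {a} (by simpa using hX (Finset.mem_insert_self a X)) (by simp),
        Finset.insert_comm] at s
      omega
  have h1 : ∀ X ⊆ N, X.Nonempty → g X ∅ = 1 := by
    intro X
    induction X using Finset.induction_on with
    | empty => simp
    | insert a X haX ih =>
      intro hX _
      have hX' : X ⊆ N := (Finset.subset_insert a X).trans hX
      have ha : a ∈ N := hX (by simp)
      rcases X.eq_empty_or_nonempty with rfl | hX0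
      · simpa using h.singleton_left a
      · refine h.good.eq_one_of_pair hc (a := x) (by simp) (by simpa) ?_ (fun hw => hxN (hX' hw))
          (by simp) haX (by simp) (ih hX' hX0) (hx1 X hX') ?_
        · rintro rfl
          exact hxN ha
        · rw [Finset.insert_comm]
          exact hx1 _ hX
  have s := hc.split ∅ N x
  rw [h.right_eq_one hne h1, hF, insert_empty_eq, hcone N hNc hxN hne] at s
  omega

/-- Two vertices agree if they are equal or the pair has value one. -/
def Agree (g : Finset V → Finset V → ℤ) (u v : V) : Prop := u = v ∨ g {u, v} ∅ = 1

theorem agree_symm {u v : V} (huv : Agree g u v) : Agree g v u := by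
  rcases huv with rfl | huv
  · exact Or.inl rfl
  · exact Or.inr (by rwa [Finset.pair_comm])

theorem agree_trans (h : IsExtremal G g) {u v w : V} (huv : Agree g u v) (hvw : Agree g v w) :
    Agree g u w := by
  by_cases huw : u = w
  · exact Or.inl huw
  rcases huv with rfl | huv'
  · exact hvw
  rcases hvw with rfl | hvw'
  · exact Or.inr huv'
  by_cases h1 : u = v
  · exact Or.inr (h1 ▸ hvw')
  by_cases h2 : v = w
  · exact Or.inr (h2 ▸ huv')
  exact Or.inr (h.pair_trans (Ne.symm h1) h2 huw (by rwa [Finset.pair_comm]) hvw')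

theorem not_agree_of_adj (h : IsExtremal G g) {u v : V} (huv : G.Adj u v) : ¬ Agree g u v := by
  rintro (rfl | h1)
  · exact G.loopless.irrefl _ huv
  · rw [h.pair_eq_zero huv] at h1
    omega

theorem pair_eq_zero_of_not_agree (h : IsExtremal G g) {u v : V} (huv : ¬ Agree g u v) :
    g {u, v} ∅ = 0 := by
  unfold Agree at huv
  push Not at huv
  exact (h.pair_eq huv.1).resolve_right huv.2

theorem left_of_edge (h : IsExtremal G g) {a b c : V} (hab : G.Adj a b)
    (hac : ¬ Agree g c a) (hbc : ¬ Agree g c b) : g {c} {a, b} = 1 := by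
  have s1 := h.counter.split {c} {b} a
  have s2 := h.counter.split {a, c} ∅ b
  have e1 := h.left_right c b
  rw [h.pair_eq_zero_of_not_agree hbc] at e1
  have e2 := h.pair_eq_zero_of_not_agree hac
  rw [Finset.pair_comm] at e2
  have e3 : g {b, a, c} ∅ = 0 := h.counter.eq_zero_of_adj ∅ (by simp) (by simp) hab
  simp only [insert_empty_eq] at s2
  omega

/-- Two edges cannot have four pairwise disagreeing ends. -/
theorem edges_meet (h : IsExtremal G g) {a b c d : V} (hab : G.Adj a b) (hcd : G.Adj c d)
    (hca : ¬ Agree g c a) (hcb : ¬ Agree g c b) (hda : ¬ Agree g d a) (hdb : ¬ Agree g d b) :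
    False := by
  have e0 := h.pair_right a b
  rw [h.pair_eq_zero hab] at e0
  have e1 := h.left_of_edge hab hca hcb
  have e2 : g {d} {c, a, b} = 1 := by
    rw [h.counter.insert_of_adj _ (a := d) (by simp) hcd.symm, h.left_of_edge hab hda hdb]
  have s1 := h.counter.split ∅ {a, b} c
  have s2 := h.counter.split ∅ {c, a, b} d
  have b1 := h.good.bound (X := ∅) (Y := {d, c, a, b}) (by simp) (by simp)
  simp only [insert_empty_eq] at s1 s2
  omega

theorem exists_coloring [Nonempty V] (h : IsExtremal G g) : ∃ φ : V → ZMod 3,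
    (∀ u v, G.Adj u v → φ u ≠ φ v) ∧ ∀ v, ∃ w, G.Adj v w ∧ φ w = φ v + 1 := by
  obtain ⟨x⟩ := ‹Nonempty V›
  obtain ⟨y, z, hxy, hxz, hyz', hyz0⟩ := h.exists_neighbors x
  have hyz : ¬ Agree g y z := by
    rintro (h1 | h1)
    · exact hyz' h1
    · omega
  have nxy := h.not_agree_of_adj hxy
  have nxz := h.not_agree_of_adj hxz
  have nbr : ∀ v, ∃ w w', G.Adj v w ∧ G.Adj v w' ∧ ¬ Agree g w w' := by
    intro v
    obtain ⟨w, w', h1, h2, h3, h4⟩ := h.exists_neighbors v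
    refine ⟨w, w', h1, h2, ?_⟩
    rintro (h5 | h5)
    · exact h3 h5
    · omega
  have cover : ∀ v, Agree g v x ∨ Agree g v y ∨ Agree g v z := by
    intro v
    by_contra! hv
    obtain ⟨vx, vy, vz⟩ := hv
    have toX : ∀ w, G.Adj v w → Agree g w x := by
      intro w hvw
      by_contra hwx
      have wy : Agree g w y := by
        by_contra hwy
        exact h.edges_meet hxy hvw vx vy hwx hwy
      have wz : Agree g w z := by
        by_contra hwz
        exact h.edges_meet hxz hvw vx vz hwx hwz
      exact hyz (h.agree_trans (agree_symm wy) wz)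
    obtain ⟨w, w', h1, h2, h3⟩ := nbr v
    exact h3 (h.agree_trans (toX w h1) (agree_symm (toX w' h2)))
  let φ : V → ZMod 3 := fun v => if Agree g v x then 0 else if Agree g v y then 1 else 2
  have hφ : ∀ u v, φ u = φ v ↔ Agree g u v := by
    intro u v
    have cu := cover u
    have cv := cover v
    have s : ∀ {a b}, Agree g a b → Agree g b a := agree_symm
    have t : ∀ {a b c}, Agree g a b → Agree g b c → Agree g a c := h.agree_trans
    have n01 : (0 : ZMod 3) ≠ 1 := by decide
    have n02 : (0 : ZMod 3) ≠ 2 := by decide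
    have n12 : (1 : ZMod 3) ≠ 2 := by decide
    simp only [φ]
    split_ifs <;> grind
  refine ⟨φ, fun u v huv h1 => h.not_agree_of_adj huv ((hφ u v).1 h1), fun v => ?_⟩
  obtain ⟨w, w', h1, h2, h3⟩ := nbr v
  have n1 : φ v ≠ φ w := fun h0 => h.not_agree_of_adj h1 ((hφ v w).1 h0)
  have n2 : φ v ≠ φ w' := fun h0 => h.not_agree_of_adj h2 ((hφ v w').1 h0)
  have n3 : φ w ≠ φ w' := fun h0 => h3 ((hφ w w').1 h0)
  have three : ∀ p q r : ZMod 3, p ≠ q → p ≠ r → q ≠ r → q = p + 1 ∨ r = p + 1 := by decide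
  rcases three _ _ _ n1 n2 n3 with h4 | h4
  · exact ⟨w, h1, h4⟩
  · exact ⟨w', h2, h4⟩

end IsExtremal

/-! ### Shortest directed cycles -/

/-- `s` is an infinite walk along `R` with period `n`. -/
def IsPeriodicWalk {α : Type*} (R : α → α → Prop) (n : ℕ) (s : ℕ → α) : Prop :=
  0 < n ∧ (∀ k, R (s k) (s (k + 1))) ∧ ∀ k, s (k + n) = s k

theorem exists_isPeriodicWalk_of_closing {α : Type*} {R : α → α → Prop} {s : ℕ → α}
    (hs : ∀ k, R (s k) (s (k + 1))) (t m : ℕ) (h : R (s (t + m)) (s t)) :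
    ∃ s', IsPeriodicWalk R (m + 1) s' := by
  refine ⟨fun k => s (t + k % (m + 1)), by omega, fun k => ?_, fun k => by simp⟩
  have hlt : k % (m + 1) < m + 1 := Nat.mod_lt _ (by omega)
  by_cases hk : k % (m + 1) = m
  · have : (k + 1) % (m + 1) = 0 := by
      rw [Nat.add_mod, hk]
      rcases m with _ | m <;> simp
    simpa [hk, this] using h
  · have : (k + 1) % (m + 1) = k % (m + 1) + 1 := by
      rw [← Nat.mod_add_mod]
      exact Nat.mod_eq_of_lt (by omega)
    dsimp only
    rw [this]
    exact hs _

theorem exists_isPeriodicWalk {α : Type*} [Finite α] [Nonempty α] {R : α → α → Prop}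
    (hR : ∀ v, ∃ w, R v w) : ∃ n s, IsPeriodicWalk R n s := by
  choose f hf using hR
  obtain ⟨v⟩ := ‹Nonempty α›
  have hs : ∀ k, R (f^[k] v) (f^[k + 1] v) := fun k => by
    rw [Function.iterate_succ_apply']
    exact hf _
  obtain ⟨i, j, hij, he⟩ := Finite.exists_ne_map_eq_of_infinite fun k => f^[k] v
  wlog hlt : i < j generalizing i j
  · exact this j i hij.symm he.symm (by omega)
  obtain ⟨m, rfl⟩ := Nat.exists_eq_add_of_lt hlt
  refine ⟨m + 1, exists_isPeriodicWalk_of_closing (s := fun k => f^[k] v) hs i m ?_⟩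
  rw [he]
  exact hs (i + m)

theorem exists_cycleGraph_embedding {V : Type*} [Finite V] [Nonempty V] {G : SimpleGraph V}
    (φ : V → ZMod 3) (hφ : ∀ u v, G.Adj u v → φ u ≠ φ v)
    (hnext : ∀ v, ∃ w, G.Adj v w ∧ φ w = φ v + 1) :
    ∃ n, 3 ≤ n ∧ 3 ∣ n ∧ Nonempty (SimpleGraph.cycleGraph n ↪g G) := by
  let R : V → V → Prop := fun u v => G.Adj u v ∧ φ v = φ u + 1
  have hex : ∃ n s, IsPeriodicWalk R n s := exists_isPeriodicWalk hnext
  obtain ⟨s, hpos, hs, hper⟩ := Nat.find_spec hex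
  have hmin : ∀ t m, R (s (t + m)) (s t) → Nat.find hex ≤ m + 1 := fun t m h =>
    Nat.find_min' hex (exists_isPeriodicWalk_of_closing hs t m h)
  generalize Nat.find hex = n at hpos hper hmin
  have hcol : ∀ k, φ (s k) = φ (s 0) + k := by
    intro k
    induction k with
    | zero => simp
    | succ k ih => rw [(hs k).2, ih]; push_cast; ring
  have hdvd : 3 ∣ n := by
    have h1 := hcol n
    have h2 := hper 0
    rw [zero_add] at h2
    rw [h2, left_eq_add] at h1
    exact (ZMod.natCast_eq_zero_iff n 3).1 h1
  have hn3 : 3 ≤ n := Nat.le_of_dvd hpos hdvd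
  have hinj : ∀ i j, i < j → j < n → s i ≠ s j := by
    intro i j hij hj he
    obtain ⟨m, rfl⟩ := Nat.exists_eq_add_of_lt hij
    have h1 := hs (i + m)
    rw [← he] at h1
    have := hmin i m h1
    omega
  have hstep : ∀ i j, i < n → j < n → R (s i) (s j) → j = i + 1 ∨ (j = 0 ∧ i + 1 = n) := by
    intro i j hi hj hR
    rcases le_or_gt j i with hji | hij
    · have := hmin j (i - j) (by rwa [Nat.add_sub_cancel' hji])
      omega
    · have := hmin j (n + i - j) (by rwa [Nat.add_sub_cancel' (by omega), add_comm, hper])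
      omega
  have hR : ∀ u v, G.Adj u v → R u v ∨ R v u := by
    intro u v huv
    have three : ∀ p q : ZMod 3, p ≠ q → q = p + 1 ∨ p = q + 1 := by decide
    rcases three _ _ (hφ u v huv) with h1 | h1
    · exact Or.inl ⟨huv, h1⟩
    · exact Or.inr ⟨huv.symm, h1⟩
  refine ⟨n, hn3, hdvd, ?_⟩
  obtain ⟨m, rfl⟩ : ∃ m, n = m + 2 := ⟨n - 2, by omega⟩
  have hsucc : ∀ i : Fin (m + 2), R (s i) (s (i + 1 : Fin (m + 2))) := by
    intro i
    have h1 := hs i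
    rw [Fin.val_add_one]
    split_ifs with hi
    · rw [hi] at h1
      have := hper 0
      rw [zero_add] at this
      rw [← this, hi]
      exact h1
    · exact h1
  have hinj' : Function.Injective fun i : Fin (m + 2) => s i := by
    intro i j hij
    rcases lt_trichotomy i j with hlt | heq | hlt
    · exact absurd hij (hinj i j hlt j.2)
    · exact heq
    · exact absurd hij.symm (hinj j i hlt i.2)
  refine ⟨⟨⟨fun i => s i, hinj'⟩, fun {i j} => ?_⟩⟩
  · have succ_of : ∀ i j : Fin (m + 2), R (s i) (s j) → j - i = 1 := by
      intro i j hij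
      rw [sub_eq_iff_eq_add']
      apply Fin.ext
      rw [Fin.val_add_one]
      have := hstep i j i.2 j.2 hij
      split_ifs with hi
      · rw [hi] at this
        simp only [Fin.val_last] at this
        have := j.2
        omega
      · have hi' : (i : ℕ) ≠ m + 1 := fun h0 => hi (Fin.ext h0)
        omega
    rw [SimpleGraph.cycleGraph_adj]
    change G.Adj (s i) (s j) ↔ _
    constructor
    · intro hadj
      rcases hR _ _ hadj with h1 | h1
      · exact Or.inr (succ_of i j h1)
      · exact Or.inl (succ_of j i h1)
    · rintro (h1 | h1)
      · rw [sub_eq_iff_eq_add'] at h1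
        rw [h1]
        exact (hsucc j).1.symm
      · rw [sub_eq_iff_eq_add'] at h1
        rw [h1]
        exact (hsucc i).1

theorem Ternary.not_isExtremal [Nonempty V] {G : SimpleGraph V} (hG : Ternary G)
    {g : Finset V → Finset V → ℤ} : ¬ IsExtremal G g := by
  intro h
  obtain ⟨φ, h1, h2⟩ := h.exists_coloring
  obtain ⟨n, h3, h4, ⟨e⟩⟩ := exists_cycleGraph_embedding φ h1 h2
  exact (hG n h3 h4).false e

theorem good_counter_ternary (G : SimpleGraph V) (hG : Ternary G)
    (g : Finset V → Finset V → ℤ) (hc : IsCounter G g) (hg : IsGood g) :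
    |g ∅ ∅| ≤ 1 := by
  rcases isEmpty_or_nonempty V with hV | ⟨⟨v⟩⟩
  · have : fG G ∅ ∅ = 1 := by
      simp [fG, Finset.univ_unique, Finset.eq_empty_of_isEmpty]
    rcases hc with rfl | rfl <;> simp [this]
  have : Nonempty V := ⟨v⟩
  have h1 : g ∅ ∅ ≠ 2 := fun h => hG.not_isExtremal ⟨hc, hg, h⟩
  have h2 : g ∅ ∅ ≠ -2 := fun h => hG.not_isExtremal ⟨hc.neg, hg.neg, by simp [h]⟩
  have s := hc.split ∅ ∅ v
  have b1 := hg.bound (X := {v}) (Y := ∅) (by simp) (by simp)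
  have b2 := hg.bound (X := ∅) (Y := {v}) (by simp) (by simp)
  simp only [insert_empty_eq] at s
  rw [abs_le]
  omega
end

section
/- If G is a ternary graph, then the number of stable sets of G with even cardinality and the number of stable sets with odd cardinality differ by at most one; equivalently |Σ_{A stable} (-1)^{|A|}| ≤ 1. -/
open Finset
open scoped Classical

variable {V : Type*} [Fintype V]

namespace IndependenceComplex

set_option linter.unusedSectionVars false

/-- Mod 2 chains on the full simplex spanned by `V`, including the empty face. -/
abbrev Chain (V : Type*) := Finset V → ZMod 2

/-- The augmented simplicial boundary map. -/
noncomputable def bd : Chain V →ₗ[ZMod 2] Chain V where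
  toFun c A := ∑ x, if x ∈ A then 0 else c (insert x A)
  map_add' c c' := by
    ext A
    simp only [Pi.add_apply, ← Finset.sum_add_distrib]
    exact Finset.sum_congr rfl fun x _ => by split_ifs <;> simp
  map_smul' r c := by
    ext A
    simp only [Pi.smul_apply, smul_eq_mul, RingHom.id_apply, Finset.mul_sum]
    exact Finset.sum_congr rfl fun x _ => by split_ifs <;> simp

/-- The part of a chain supported on the faces containing `v`, with `v` removed. -/
noncomputable def linkPart (v : V) : Chain V →ₗ[ZMod 2] Chain V where
  toFun c A := if v ∈ A then 0 else c (insert v A)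
  map_add' c c' := by ext A; by_cases h : v ∈ A <;> simp [h]
  map_smul' r c := by ext A; by_cases h : v ∈ A <;> simp [h]

/-- The part of a chain supported on the faces avoiding `v`. -/
noncomputable def delPart (v : V) : Chain V →ₗ[ZMod 2] Chain V where
  toFun c A := if v ∈ A then 0 else c A
  map_add' c c' := by ext A; by_cases h : v ∈ A <;> simp [h]
  map_smul' r c := by ext A; by_cases h : v ∈ A <;> simp [h]

/-- The cone with apex `v` over a chain. -/
noncomputable def cone (v : V) : Chain V →ₗ[ZMod 2] Chain V where
  toFun c A := if v ∈ A then c (A.erase v) else 0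
  map_add' c c' := by ext A; by_cases h : v ∈ A <;> simp [h]
  map_smul' r c := by ext A; by_cases h : v ∈ A <;> simp [h]

/-- The part of a chain supported on the faces whose cardinality satisfies `p`. -/
noncomputable def restr (p : ℕ → Prop) : Chain V →ₗ[ZMod 2] Chain V where
  toFun c A := if p A.card then c A else 0
  map_add' c c' := by ext A; by_cases h : p A.card <;> simp [h]
  map_smul' r c := by ext A; by_cases h : p A.card <;> simp [h]

theorem bd_apply (c : Chain V) (A : Finset V) :
    bd c A = ∑ x, if x ∈ A then 0 else c (insert x A) := rfl

theorem linkPart_apply (v : V) (c : Chain V) (A : Finset V) :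
    linkPart v c A = if v ∈ A then 0 else c (insert v A) := rfl

theorem delPart_apply (v : V) (c : Chain V) (A : Finset V) :
    delPart v c A = if v ∈ A then 0 else c A := rfl

theorem cone_apply (v : V) (c : Chain V) (A : Finset V) :
    cone v c A = if v ∈ A then c (A.erase v) else 0 := rfl

theorem restr_apply (p : ℕ → Prop) (c : Chain V) (A : Finset V) :
    restr p c A = if p A.card then c A else 0 := rfl

theorem chain_add_self (c : Chain V) : c + c = 0 := ZModModule.add_self c

theorem bd_bd (c : Chain V) : bd (bd c) = 0 := by
  ext A
  have h : bd (bd c) A = ∑ p : V × V, if p.1 ∈ A ∨ p.2 ∈ A ∨ p.1 = p.2 then 0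
      else c (insert p.2 (insert p.1 A)) := by
    rw [Fintype.sum_prod_type, bd_apply]
    refine Finset.sum_congr rfl fun x _ => ?_
    split_ifs with hx
    · simp [hx]
    · rw [bd_apply]
      refine Finset.sum_congr rfl fun y _ => ?_
      have : y ∈ insert x A ↔ x ∈ A ∨ y ∈ A ∨ x = y := by grind
      simp only [this]
  rw [h, Pi.zero_apply]
  refine Finset.sum_involution (fun p _ => p.swap) ?_ ?_ (by simp) (by simp)
  · rintro ⟨x, y⟩ -
    simp only [Prod.swap, Finset.insert_comm x y A]
    have : (x ∈ A ∨ y ∈ A ∨ x = y) ↔ (y ∈ A ∨ x ∈ A ∨ y = x) := by grind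
    simp only [this]
    exact ZModModule.add_self _
  · rintro ⟨x, y⟩ - h heq
    simp only [Prod.swap, Prod.mk.injEq] at heq
    exact h (by simp [heq.2])

theorem delPart_add_cone_linkPart (v : V) (c : Chain V) :
    delPart v c + cone v (linkPart v c) = c := by
  ext A
  by_cases h : v ∈ A <;> simp [delPart_apply, cone_apply, linkPart_apply, h]

theorem linkPart_bd (v : V) (c : Chain V) : linkPart v (bd c) = bd (linkPart v c) := by
  ext A
  by_cases h : v ∈ A
  · simp [linkPart_apply, bd_apply, h]
  · simp only [linkPart_apply, bd_apply, h, if_false]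
    refine Finset.sum_congr rfl fun x _ => ?_
    rw [Finset.insert_comm]
    grind

theorem delPart_bd (v : V) (c : Chain V) :
    delPart v (bd c) = bd (delPart v c) + linkPart v c := by
  ext A
  by_cases h : v ∈ A
  · simp [linkPart_apply, delPart_apply, bd_apply, h]
  · simp only [Pi.add_apply, linkPart_apply, delPart_apply, bd_apply, h, if_false]
    rw [← Finset.add_sum_erase _ _ (Finset.mem_univ v),
      ← Finset.add_sum_erase _ _ (Finset.mem_univ v)]
    simp only [h, if_false, Finset.mem_insert_self, if_true, zero_add]
    rw [add_comm]
    congr 1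
    refine Finset.sum_congr rfl fun x hx => ?_
    simp only [Finset.mem_insert, h, or_false, (Finset.ne_of_mem_erase hx).symm, if_false]

theorem linkPart_delPart (v : V) (c : Chain V) : linkPart v (delPart v c) = 0 := by
  ext A
  simp [linkPart_apply, delPart_apply]

theorem delPart_cone (v : V) (c : Chain V) : delPart v (cone v c) = 0 := by
  ext A
  by_cases h : v ∈ A <;> simp [cone_apply, delPart_apply, h]

theorem linkPart_cone (v : V) (c : Chain V) : linkPart v (cone v c) = delPart v c := by
  ext A
  by_cases h : v ∈ A <;> simp [cone_apply, linkPart_apply, delPart_apply, h]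

theorem bd_delPart (v : V) (c : Chain V) :
    bd (delPart v c) = delPart v (bd c) + linkPart v c := by
  rw [delPart_bd, add_assoc, chain_add_self, add_zero]

theorem bd_cone (v : V) (c : Chain V) :
    bd (cone v (delPart v c)) = delPart v c + cone v (bd (delPart v c)) := by
  rw [← delPart_add_cone_linkPart v (bd (cone v (delPart v c))), linkPart_bd, linkPart_cone,
    delPart_bd, delPart_cone, linkPart_cone]
  have h : delPart v (delPart v c) = delPart v c := by
    ext A
    by_cases h : v ∈ A <;> simp [delPart_apply, h]
  rw [h, map_zero, zero_add]

theorem bd_restr (p : ℕ → Prop) (c : Chain V) :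
    bd (restr p c) = restr (fun n => p (n + 1)) (bd c) := by
  ext A
  by_cases h : p (A.card + 1)
  · simp only [restr_apply, bd_apply, h, if_true]
    refine Finset.sum_congr rfl fun x _ => ?_
    split_ifs with hx h'
    · rfl
    · rfl
    · rw [Finset.card_insert_of_notMem hx] at h'
      exact absurd h h'
  · simp only [restr_apply, bd_apply, h, if_false]
    refine Finset.sum_eq_zero fun x _ => ?_
    split_ifs with hx h'
    · rfl
    · rw [Finset.card_insert_of_notMem hx] at h'
      exact absurd h' h
    · rfl

section

/-- `A` is a stable set of `G`. -/
def Stable (G : SimpleGraph V) (A : Finset V) : Prop := ∀ u ∈ A, ∀ v ∈ A, ¬ G.Adj u v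

/-- The chains of the independence complex of the subgraph of `G` induced on `W`. -/
def chains (G : SimpleGraph V) (W : Set V) : Submodule (ZMod 2) (Chain V) where
  carrier := {c | ∀ A, c A ≠ 0 → Stable G A ∧ (A : Set V) ⊆ W}
  add_mem' {a b} ha hb A h := by
    by_cases h' : a A = 0
    · exact hb A fun h'' => h (by simp [h', h''])
    · exact ha A h'
  zero_mem' A h := absurd rfl h
  smul_mem' r c hc A h := hc A fun h' => h (by simp [h'])

/-- The cycles of the independence complex of the subgraph of `G` induced on `W`. -/
noncomputable def cycles (G : SimpleGraph V) (W : Set V) : Submodule (ZMod 2) (Chain V) :=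
  chains G W ⊓ LinearMap.ker bd

/-- The boundaries of the independence complex of the subgraph of `G` induced on `W`. -/
noncomputable def boundaries (G : SimpleGraph V) (W : Set V) : Submodule (ZMod 2) (Chain V) :=
  (chains G W).map bd

/-- The vertices of `W` other than `v` that are not adjacent to `v`. -/
def lk (G : SimpleGraph V) (W : Set V) (v : V) : Set V := {x | x ∈ W ∧ x ≠ v ∧ ¬ G.Adj v x}

variable {G : SimpleGraph V} {W W' : Set V} {v : V} {c z : Chain V}

theorem mem_lk {x : V} : x ∈ lk G W v ↔ x ∈ W ∧ x ≠ v ∧ ¬ G.Adj v x := Iff.rfl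

theorem mem_cycles : z ∈ cycles G W ↔ z ∈ chains G W ∧ bd z = 0 := Iff.rfl

theorem Stable.subset {A B : Finset V} (h : Stable G B) (hAB : A ⊆ B) : Stable G A :=
  fun u hu v hv => h u (hAB hu) v (hAB hv)

theorem chains_mono (h : W ⊆ W') : chains G W ≤ chains G W' :=
  fun _ hc A hA => ⟨(hc A hA).1, (hc A hA).2.trans h⟩

theorem cycles_mono (h : W ⊆ W') : cycles G W ≤ cycles G W' :=
  inf_le_inf_right _ (chains_mono h)

theorem boundaries_mono (h : W ⊆ W') : boundaries G W ≤ boundaries G W' :=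
  Submodule.map_mono (chains_mono h)

theorem lk_subset_diff : lk G W v ⊆ W \ {v} := fun _ hx => ⟨hx.1, hx.2.1⟩

theorem lk_subset : lk G W v ⊆ W := fun _ hx => hx.1

theorem bd_mem_chains (h : c ∈ chains G W) : bd c ∈ chains G W := by
  intro A hA
  rw [bd_apply] at hA
  obtain ⟨x, -, hx⟩ := Finset.exists_ne_zero_of_sum_ne_zero hA
  by_cases hxA : x ∈ A
  · simp [hxA] at hx
  · rw [if_neg hxA] at hx
    obtain ⟨h1, h2⟩ := h _ hx
    exact ⟨h1.subset (Finset.subset_insert x A), (Finset.coe_subset.2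
      (Finset.subset_insert x A)).trans h2⟩

theorem bd_mem_boundaries (h : c ∈ chains G W) : bd c ∈ boundaries G W := ⟨c, h, rfl⟩

theorem linkPart_mem_chains (h : c ∈ chains G W) : linkPart v c ∈ chains G (lk G W v) := by
  intro A hA
  rw [linkPart_apply] at hA
  by_cases hv : v ∈ A
  · simp [hv] at hA
  · rw [if_neg hv] at hA
    obtain ⟨h1, h2⟩ := h _ hA
    refine ⟨h1.subset (Finset.subset_insert v A), fun x hx => ⟨h2 ?_, ?_, ?_⟩⟩
    · exact Finset.mem_coe.2 (Finset.mem_insert_of_mem hx)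
    · rintro rfl
      exact hv hx
    · exact h1 v (Finset.mem_insert_self v A) x (Finset.mem_insert_of_mem hx)

theorem linkPart_mem_cycles (h : z ∈ cycles G W) : linkPart v z ∈ cycles G (lk G W v) :=
  mem_cycles.2 ⟨linkPart_mem_chains h.1, by
    rw [← linkPart_bd, (mem_cycles.1 h).2, map_zero]⟩

theorem linkPart_mem_boundaries (h : z ∈ boundaries G W) :
    linkPart v z ∈ boundaries G (lk G W v) := by
  obtain ⟨c, hc, rfl⟩ := h
  exact ⟨linkPart v c, linkPart_mem_chains hc, (linkPart_bd v c).symm⟩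

theorem delPart_mem_chains (h : c ∈ chains G W) : delPart v c ∈ chains G (W \ {v}) := by
  intro A hA
  rw [delPart_apply] at hA
  by_cases hv : v ∈ A
  · simp [hv] at hA
  · rw [if_neg hv] at hA
    obtain ⟨h1, h2⟩ := h _ hA
    refine ⟨h1, fun x hx => ⟨h2 hx, ?_⟩⟩
    rintro rfl
    exact hv hx

theorem delPart_eq_self (h : c ∈ chains G W) (hv : v ∉ W) : delPart v c = c := by
  ext A
  rw [delPart_apply]
  split_ifs with hA
  · by_contra hc
    exact hv ((h A (Ne.symm hc)).2 hA)
  · rfl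

theorem linkPart_eq_zero (h : c ∈ chains G W) (hv : v ∉ W) : linkPart v c = 0 := by
  rw [← delPart_eq_self h hv, linkPart_delPart]

theorem cone_mem_chains (hv : v ∈ W) (h : c ∈ chains G (lk G W v)) : cone v c ∈ chains G W := by
  intro A hA
  rw [cone_apply] at hA
  by_cases hvA : v ∈ A
  · rw [if_pos hvA] at hA
    obtain ⟨h1, h2⟩ := h _ hA
    have h3 : ∀ x ∈ A, x = v ∨ x ∈ A.erase v := fun x hx => by grind
    constructor
    · intro x hx y hy
      rcases h3 x hx with rfl | hx' <;> rcases h3 y hy with rfl | hy'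
      · exact G.irrefl
      · exact (h2 hy').2.2
      · exact fun hadj => (h2 hx').2.2 hadj.symm
      · exact h1 x hx' y hy'
    · intro x hx
      rcases h3 x hx with rfl | hx'
      · exact hv
      · exact (h2 hx').1
  · simp [hvA] at hA

theorem bd_cone_of_mem (h : c ∈ chains G W) (hv : v ∉ W) :
    bd (cone v c) = c + cone v (bd c) := by
  have := bd_cone v c
  rwa [delPart_eq_self h hv] at this

theorem bd_cone_of_mem_cycles (h : z ∈ cycles G W) (hv : v ∉ W) : bd (cone v z) = z := by
  rw [bd_cone_of_mem h.1 hv, (mem_cycles.1 h).2, map_zero, add_zero]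

theorem notMem_lk : v ∉ lk G W v := fun h => h.2.1 rfl

theorem notMem_diff : v ∉ W \ {v} := fun h => h.2 rfl

theorem lk_cycle_mem_boundaries (hv : v ∈ W) (h : z ∈ cycles G (lk G W v)) :
    z ∈ boundaries G W :=
  ⟨cone v z, cone_mem_chains hv h.1, bd_cone_of_mem_cycles h notMem_lk⟩

/-- A cycle avoiding `v` that bounds is homologous, away from `v`, to a cycle of the link. -/
theorem exists_lk_cycle_of_mem_boundaries (hz : z ∈ chains G (W \ {v}))
    (hc : c ∈ chains G W) (h : bd c = z) :
    linkPart v c ∈ cycles G (lk G W v) ∧ z + linkPart v c = bd (delPart v c) := by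
  refine ⟨mem_cycles.2 ⟨linkPart_mem_chains hc, ?_⟩, ?_⟩
  · rw [← linkPart_bd, h, linkPart_eq_zero hz notMem_diff]
  · rw [bd_delPart, h, delPart_eq_self hz notMem_diff]

/-- A cycle whose link part bounds can be pushed off `v`. -/
theorem push_off (hz : z ∈ cycles G W) {e : Chain V} (he : e ∈ chains G (lk G W v))
    (h : bd e = linkPart v z) :
    delPart v z + e ∈ cycles G (W \ {v}) ∧ z + (delPart v z + e) = bd (cone v e) := by
  refine ⟨mem_cycles.2 ⟨add_mem (delPart_mem_chains hz.1) (chains_mono lk_subset_diff he), ?_⟩, ?_⟩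
  · rw [map_add, h, bd_delPart, (mem_cycles.1 hz).2, map_zero, zero_add,
      chain_add_self]
  · rw [bd_cone_of_mem he notMem_lk, h]
    nth_rw 1 [← delPart_add_cone_linkPart v z]
    rw [show ∀ a b c : Chain V, a + b + (a + c) = a + a + (c + b) by intros; abel,
      chain_add_self, zero_add]

/-- A cycle of the link that bounds away from `v` lifts to a cycle. -/
theorem lift_lk_cycle (hv : v ∈ W) (hz : z ∈ cycles G (lk G W v)) {e : Chain V}
    (he : e ∈ chains G (W \ {v})) (h : bd e = z) :
    cone v z + e ∈ cycles G W ∧ linkPart v (cone v z + e) = z := by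
  refine ⟨mem_cycles.2
    ⟨add_mem (cone_mem_chains hv hz.1) (chains_mono Set.sdiff_subset he), ?_⟩, ?_⟩
  · rw [map_add, bd_cone_of_mem_cycles hz notMem_lk, h, chain_add_self]
  · rw [map_add, linkPart_cone, linkPart_eq_zero he notMem_diff, add_zero,
      delPart_eq_self hz.1 notMem_lk]

end

section

/-- All faces in the support of `c` have cardinality `j`. -/
def Homog (j : ℕ) (c : Chain V) : Prop := ∀ A, c A ≠ 0 → A.card = j

/-- Some cycle on faces of cardinality `j` does not bound. -/
def Nz (G : SimpleGraph V) (j : ℕ) (W : Set V) : Prop :=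
  ∃ z ∈ cycles G W, Homog j z ∧ z ∉ boundaries G W

/-- Every cycle bounds. -/
def Acyc (G : SimpleGraph V) (W : Set V) : Prop := cycles G W ≤ boundaries G W

/-- The total homology has dimension at most one. -/
def AtMostOne (G : SimpleGraph V) (W : Set V) : Prop :=
  ∀ z ∈ cycles G W, ∀ z' ∈ cycles G W,
    z ∈ boundaries G W ∨ z' ∈ boundaries G W ∨ z + z' ∈ boundaries G W

variable {G : SimpleGraph V} {W W' : Set V} {v : V} {c c' z : Chain V} {i j : ℕ}

theorem Homog.add (h : Homog j c) (h' : Homog j c') : Homog j (c + c') := by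
  intro A hA
  by_cases h0 : c A = 0
  · exact h' A fun h'' => hA (by simp [h0, h''])
  · exact h A h0

theorem Homog.linkPart (h : Homog (j + 1) c) : Homog j (linkPart v c) := by
  intro A hA
  rw [linkPart_apply] at hA
  split_ifs at hA with hv
  · exact absurd rfl hA
  · have := h _ hA
    rw [Finset.card_insert_of_notMem hv] at this
    omega

theorem Homog.linkPart_zero (h : Homog 0 c) : IndependenceComplex.linkPart v c = 0 := by
  ext A
  rw [linkPart_apply]
  split_ifs with hv
  · rfl
  · by_contra hne
    simpa using h _ hne

theorem Homog.delPart (h : Homog j c) : Homog j (delPart v c) := by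
  intro A hA
  rw [delPart_apply] at hA
  split_ifs at hA with hv
  · exact absurd rfl hA
  · exact h _ hA

theorem Homog.cone (h : Homog j c) : Homog (j + 1) (cone v c) := by
  intro A hA
  rw [cone_apply] at hA
  split_ifs at hA with hv
  · rw [← h _ hA, Finset.card_erase_add_one hv]
  · exact absurd rfl hA

theorem Homog.restr_eq (h : Homog j c) : restr (· = j) c = c := by
  ext A
  rw [restr_apply]
  split_ifs with hA
  · rfl
  · by_contra hne
    exact hA (h A (Ne.symm hne))

theorem homog_restr : Homog j (restr (· = j) c) := by
  intro A hA
  rw [restr_apply] at hA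
  split_ifs at hA with h
  · exact h
  · exact absurd rfl hA

theorem restr_mem_chains {p : ℕ → Prop} (h : c ∈ chains G W) : restr p c ∈ chains G W := by
  intro A hA
  rw [restr_apply] at hA
  split_ifs at hA with hp
  · exact h A hA
  · exact absurd rfl hA

theorem restr_mem_cycles {p : ℕ → Prop} (h : z ∈ cycles G W) : restr p z ∈ cycles G W :=
  mem_cycles.2 ⟨restr_mem_chains h.1, by rw [bd_restr, (mem_cycles.1 h).2, map_zero]⟩

theorem restr_mem_boundaries {p : ℕ → Prop} (h : z ∈ boundaries G W) :
    restr p z ∈ boundaries G W := by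
  obtain ⟨c, hc, rfl⟩ := h
  refine ⟨restr (fun n => p (n - 1)) c, restr_mem_chains hc, ?_⟩
  rw [bd_restr]
  rfl

theorem Homog.exists_bd_eq (h : Homog j z) (hz : z ∈ boundaries G W) :
    ∃ c ∈ chains G W, Homog (j + 1) c ∧ bd c = z := by
  obtain ⟨c, hc, rfl⟩ := hz
  refine ⟨restr (· = j + 1) c, restr_mem_chains hc, homog_restr, ?_⟩
  rw [bd_restr]
  simpa using h.restr_eq

theorem restr_eq_zero_of_ne (h : Homog j c) (hij : i ≠ j) : restr (· = i) c = 0 := by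
  ext A
  rw [restr_apply]
  split_ifs with hA
  · by_contra hne
    exact hij (hA.symm.trans (h A hne))
  · rfl

theorem AtMostOne.degree_unique (h : AtMostOne G W) (hi : Nz G i W) (hj : Nz G j W) : i = j := by
  obtain ⟨z, hz, hzi, hzB⟩ := hi
  obtain ⟨z', hz', hzj, hzB'⟩ := hj
  by_contra hij
  rcases h z hz z' hz' with h | h | h
  · exact hzB h
  · exact hzB' h
  · apply hzB
    have := restr_mem_boundaries (p := (· = i)) h
    rwa [map_add, hzi.restr_eq, restr_eq_zero_of_ne hzj hij, add_zero] at this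

theorem eq_sum_restr (c : Chain V) :
    c = ∑ j ∈ Finset.range (Fintype.card V + 1), restr (· = j) c := by
  ext A
  rw [Finset.sum_apply]
  simp only [restr_apply]
  exact ((Finset.sum_eq_single_of_mem A.card
    (Finset.mem_range.2 (Nat.lt_succ_of_le (Finset.card_le_univ A)))
    fun j _ hj => if_neg hj.symm).trans (if_pos rfl)).symm

theorem exists_nz_of_not_acyc (h : ¬ Acyc G W) : ∃ j, Nz G j W := by
  by_contra! hno
  apply h
  intro z hz
  rw [eq_sum_restr z]
  refine sum_mem fun j _ => ?_
  by_contra hB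
  exact hno j ⟨_, restr_mem_cycles hz, homog_restr, hB⟩

theorem Nz.not_acyc (h : Nz G j W) : ¬ Acyc G W := by
  obtain ⟨z, hz, -, hB⟩ := h
  exact fun hA => hB (hA hz)

theorem mem_of_add_mem_left {S : Submodule (ZMod 2) (Chain V)} (h : c + c' ∈ S) (h' : c ∈ S) :
    c' ∈ S := (S.add_mem_iff_right h').1 h

theorem mem_of_add_mem_right {S : Submodule (ZMod 2) (Chain V)} (h : c + c' ∈ S) (h' : c' ∈ S) :
    c ∈ S := (S.add_mem_iff_left h').1 h

theorem Nz.of_diff (h : Nz G j (W \ {v})) : Nz G j (lk G W v) ∨ Nz G j W := by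
  obtain ⟨z, hz, hj, hB⟩ := h
  by_cases hzW : z ∈ boundaries G W
  · obtain ⟨c, hc, hcj, hcz⟩ := hj.exists_bd_eq hzW
    obtain ⟨h1, h2⟩ := exists_lk_cycle_of_mem_boundaries hz.1 hc hcz
    refine Or.inl ⟨_, h1, hcj.linkPart, fun hl => hB ?_⟩
    refine mem_of_add_mem_right ?_ (boundaries_mono lk_subset_diff hl)
    rw [h2]
    exact bd_mem_boundaries (delPart_mem_chains hc)
  · exact Or.inr ⟨z, cycles_mono Set.sdiff_subset hz, hj, hzW⟩

theorem Nz.of_self (hv : v ∈ W) (h : Nz G j W) :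
    Nz G j (W \ {v}) ∨ ∃ i, j = i + 1 ∧ Nz G i (lk G W v) := by
  obtain ⟨z, hz, hj, hB⟩ := h
  by_cases hl : linkPart v z ∈ boundaries G (lk G W v)
  · left
    obtain ⟨e, he, hej, hez⟩ : ∃ e ∈ chains G (lk G W v), Homog j e ∧ bd e = linkPart v z := by
      rcases j with _ | j
      · exact ⟨0, zero_mem _, fun A h => absurd rfl h, by rw [hj.linkPart_zero, map_zero]⟩
      · exact hj.linkPart.exists_bd_eq hl
    obtain ⟨h1, h2⟩ := push_off hz he hez
    refine ⟨_, h1, hj.delPart.add hej, fun hb => hB ?_⟩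
    refine mem_of_add_mem_right ?_ (boundaries_mono Set.sdiff_subset hb)
    rw [h2]
    exact bd_mem_boundaries (cone_mem_chains hv he)
  · right
    rcases j with _ | j
    · rw [hj.linkPart_zero] at hl
      exact absurd (zero_mem _) hl
    · exact ⟨j, rfl, _, linkPart_mem_cycles hz, hj.linkPart, hl⟩

theorem Nz.of_lk (hv : v ∈ W) (h : Nz G j (lk G W v)) : Nz G j (W \ {v}) ∨ Nz G (j + 1) W := by
  obtain ⟨z, hz, hj, hB⟩ := h
  by_cases hzD : z ∈ boundaries G (W \ {v})
  · right
    obtain ⟨e, he, hej, hez⟩ := hj.exists_bd_eq hzD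
    obtain ⟨h1, h2⟩ := lift_lk_cycle hv hz he hez
    refine ⟨_, h1, hj.cone.add hej, fun hb => hB ?_⟩
    rw [← h2]
    exact linkPart_mem_boundaries hb
  · exact Or.inl ⟨z, cycles_mono lk_subset_diff hz, hj, hzD⟩

theorem nz_iff_diff (hv : v ∈ W) (h : Acyc G (lk G W v)) : Nz G j W ↔ Nz G j (W \ {v}) := by
  constructor
  · intro hj
    rcases hj.of_self hv with h' | ⟨i, -, h'⟩
    · exact h'
    · exact absurd h h'.not_acyc
  · intro hj
    rcases hj.of_diff with h' | h'
    · exact absurd h h'.not_acyc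
    · exact h'

theorem nz_lk_iff (hv : v ∈ W) (h : Acyc G (W \ {v})) : Nz G j (lk G W v) ↔ Nz G (j + 1) W := by
  constructor
  · intro hj
    rcases hj.of_lk hv with h' | h'
    · exact absurd h h'.not_acyc
    · exact h'
  · intro hj
    rcases hj.of_self hv with h' | ⟨i, hi, h'⟩
    · exact absurd h h'.not_acyc
    · obtain rfl : i = j := by omega
      exact h'

theorem nz_lk_iff_diff (hv : v ∈ W) (h : Acyc G W) : Nz G j (lk G W v) ↔ Nz G j (W \ {v}) := by
  constructor
  · intro hj
    rcases hj.of_lk hv with h' | h'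
    · exact h'
    · exact absurd h h'.not_acyc
  · intro hj
    rcases hj.of_diff with h' | h'
    · exact h'
    · exact absurd h h'.not_acyc

/-- A vertex set, a deletion and the corresponding link, each with homology of dimension
at most one, cannot all have nonzero homology. -/
theorem acyc_of_atMostOne (hv : v ∈ W) (hW : AtMostOne G W) (hD : AtMostOne G (W \ {v}))
    (hK : AtMostOne G (lk G W v)) : Acyc G W ∨ Acyc G (W \ {v}) ∨ Acyc G (lk G W v) := by
  by_contra! h
  obtain ⟨hW', hD', hK'⟩ := h
  obtain ⟨w, hw, hwB⟩ := SetLike.not_le_iff_exists.1 hW'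
  obtain ⟨x, hx, hxB⟩ := SetLike.not_le_iff_exists.1 hD'
  obtain ⟨y, hy, hyB⟩ := SetLike.not_le_iff_exists.1 hK'
  by_cases hyD : y ∈ boundaries G (W \ {v})
  · obtain ⟨e, he, hey⟩ := hyD
    obtain ⟨h1, h2⟩ := lift_lk_cycle hv hy he hey
    have hxW : x ∈ boundaries G W := by
      rcases hW x (cycles_mono Set.sdiff_subset hx) _ h1 with h | h | h
      · exact h
      · exact absurd (h2 ▸ linkPart_mem_boundaries h) hyB
      · have := linkPart_mem_boundaries (v := v) h
        rw [map_add, h2, linkPart_eq_zero hx.1 notMem_diff, zero_add] at this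
        exact absurd this hyB
    obtain ⟨c, hc, hcx⟩ := hxW
    obtain ⟨h3, h4⟩ := exists_lk_cycle_of_mem_boundaries hx.1 hc hcx
    have h5 : linkPart v c ∈ boundaries G (W \ {v}) := by
      have hyD : y ∈ boundaries G (W \ {v}) := ⟨e, he, hey⟩
      rcases hK y hy _ h3 with h | h | h
      · exact absurd h hyB
      · exact boundaries_mono lk_subset_diff h
      · exact mem_of_add_mem_left (boundaries_mono lk_subset_diff h) hyD
    exact hxB (mem_of_add_mem_right (h4 ▸ bd_mem_boundaries (delPart_mem_chains hc)) h5)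
  · have hlD : linkPart v w ∈ boundaries G (W \ {v}) := by
      refine ⟨delPart v w, delPart_mem_chains hw.1, ?_⟩
      rw [bd_delPart, (mem_cycles.1 hw).2, map_zero, zero_add]
    have hlK : linkPart v w ∈ boundaries G (lk G W v) := by
      rcases hK y hy _ (linkPart_mem_cycles hw) with h | h | h
      · exact absurd h hyB
      · exact h
      · exact absurd (mem_of_add_mem_right (boundaries_mono lk_subset_diff h) hlD) hyD
    obtain ⟨e, he, hew⟩ := hlK
    obtain ⟨h1, h2⟩ := push_off hw he hew
    have h3 : delPart v w + e ∈ boundaries G W := by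
      rcases hD y (cycles_mono lk_subset_diff hy) _ h1 with h | h | h
      · exact absurd h hyD
      · exact boundaries_mono Set.sdiff_subset h
      · exact mem_of_add_mem_left (boundaries_mono Set.sdiff_subset h)
          (lk_cycle_mem_boundaries hv hy)
    exact hwB (mem_of_add_mem_right (h2 ▸ bd_mem_boundaries (cone_mem_chains hv he)) h3)

end

section

variable {G : SimpleGraph V} {W W' : Set V} {a b u v n : V} {x x' z : Chain V} {i j : ℕ}

theorem acyc_of_isolated (hv : v ∈ W) (h : ∀ x ∈ W, ¬ G.Adj v x) : Acyc G W := by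
  intro z hz
  have hlk : W \ {v} ⊆ lk G W v := fun x hx => ⟨hx.1, hx.2, h x hx.1⟩
  refine ⟨cone v (delPart v z),
    cone_mem_chains hv (chains_mono hlk (delPart_mem_chains hz.1)), ?_⟩
  rw [bd_cone, bd_delPart, (mem_cycles.1 hz).2, map_zero, zero_add, delPart_add_cone_linkPart]

theorem lk_diff_comm : lk G (W \ {b}) a = lk G W a \ {b} := by
  ext x
  simp only [mem_lk, Set.mem_sdiff, Set.mem_singleton_iff]
  tauto

theorem lk_lk_comm : lk G (lk G W a) b = lk G (lk G W b) a := by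
  ext x
  simp only [mem_lk]
  tauto

theorem diff_diff_singleton_comm : (W \ {a}) \ {b} = (W \ {b}) \ {a} := by
  ext x
  simp only [Set.mem_sdiff]
  tauto

theorem lk_diff_of_adj (h : G.Adj a b) : lk G (W \ {a}) b = lk G W b := by
  ext x
  simp only [mem_lk, Set.mem_sdiff, Set.mem_singleton_iff]
  constructor
  · tauto
  · rintro ⟨h1, h2, h3⟩
    refine ⟨⟨h1, ?_⟩, h2, h3⟩
    rintro rfl
    exact h3 h.symm

/-- Mayer-Vietoris: homologous cycles avoiding `a` and `b` respectively can be replaced by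
one cycle avoiding both. -/
theorem exists_cycle_avoiding_both (ha : a ∈ W) (hb : b ∈ W) (hab : a ≠ b)
    (hx : x ∈ cycles G (W \ {a})) (hx' : x' ∈ cycles G (W \ {b}))
    (hxx' : x + x' ∈ boundaries G W) (h : G.Adj a b ∨ Acyc G (lk G (lk G W a) b)) :
    ∃ y ∈ cycles G ((W \ {a}) \ {b}), x + y ∈ boundaries G (W \ {a}) := by
  obtain ⟨t, ht, htx⟩ := hxx'
  obtain ⟨s, hs, hst⟩ : ∃ s ∈ chains G W,
      linkPart b (linkPart a (bd s)) = linkPart b (linkPart a t) := by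
    by_cases hadj : G.Adj a b
    · refine ⟨0, zero_mem _, ?_⟩
      rw [linkPart_eq_zero (linkPart_mem_chains ht) fun hb' => hb'.2.2 hadj]
      simp
    · have hbl : b ∈ lk G W a := ⟨hb, hab.symm, hadj⟩
      obtain ⟨r, hr, hrt⟩ : linkPart b (linkPart a t) ∈ boundaries G (lk G (lk G W a) b) := by
        apply h.resolve_left hadj
        refine mem_cycles.2 ⟨linkPart_mem_chains (linkPart_mem_chains ht), ?_⟩
        rw [← linkPart_bd, ← linkPart_bd, htx, map_add, linkPart_eq_zero hx.1 notMem_diff,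
          zero_add, linkPart_eq_zero (linkPart_mem_chains hx'.1) fun hb' => hb'.1.2 rfl]
      have hbr := cone_mem_chains hbl hr
      refine ⟨cone a (cone b r), cone_mem_chains ha hbr, ?_⟩
      rw [linkPart_bd, linkPart_bd, linkPart_cone, delPart_eq_self hbr notMem_lk,
        linkPart_cone, delPart_eq_self hr notMem_lk, hrt]
  have ht' : t + bd s ∈ chains G W := add_mem ht (bd_mem_chains hs)
  have hl : linkPart b (linkPart a (t + bd s)) = 0 := by
    rw [map_add, map_add, hst, chain_add_self]
  set p := delPart a (t + bd s) with hp
  have hpW : p ∈ chains G (W \ {a}) := delPart_mem_chains ht'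
  have hbp : x + bd p = delPart a x' + linkPart a (t + bd s) := by
    rw [hp, bd_delPart, map_add bd, bd_bd, add_zero, htx, map_add (delPart a),
      delPart_eq_self hx.1 notMem_diff, add_assoc, ← add_assoc x, chain_add_self, zero_add]
  have hlm : linkPart a (t + bd s) ∈ chains G ((W \ {a}) \ {b}) := by
    rw [← delPart_add_cone_linkPart b (linkPart a (t + bd s)), hl, map_zero, add_zero]
    exact delPart_mem_chains (chains_mono lk_subset_diff (linkPart_mem_chains ht'))
  refine ⟨x + bd p, mem_cycles.2 ⟨?_, ?_⟩, ?_⟩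
  · rw [hbp]
    refine add_mem ?_ hlm
    rw [diff_diff_singleton_comm]
    exact delPart_mem_chains hx'.1
  · rw [map_add, (mem_cycles.1 hx).2, bd_bd, add_zero]
  · rw [← add_assoc, chain_add_self, zero_add]
    exact bd_mem_boundaries hpW

/-- `W` is a minimal vertex set whose homology has dimension more than one. -/
structure Critical (G : SimpleGraph V) (W : Set V) : Prop where
  not_atMostOne : ¬ AtMostOne G W
  proper : ∀ W', W' ⊂ W → AtMostOne G W'

namespace Critical

theorem diff (h : Critical G W) (hv : v ∈ W) : AtMostOne G (W \ {v}) :=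
  h.proper _ (Set.sdiff_singleton_ssubset.2 hv)

theorem link (h : Critical G W) (hv : v ∈ W) : AtMostOne G (lk G W v) :=
  h.proper _ (lk_subset_diff.trans_ssubset (Set.sdiff_singleton_ssubset.2 hv))

theorem acyc_or (h : Critical G W) (hW' : W' ⊂ W) (hv : v ∈ W') :
    Acyc G W' ∨ Acyc G (W' \ {v}) ∨ Acyc G (lk G W' v) :=
  acyc_of_atMostOne hv (h.proper _ hW') (h.proper _ (Set.sdiff_subset.trans_ssubset hW'))
    (h.proper _ (lk_subset.trans_ssubset hW'))

theorem exists_rep (h : Critical G W) (hv : v ∈ W) :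
    ∃ c ∈ cycles G (W \ {v}), ∃ d, Homog d c ∧ c ∉ boundaries G W := by
  have key : ∀ z ∈ cycles G W, z ∉ boundaries G W →
      linkPart v z ∈ boundaries G (lk G W v) →
      ∃ c ∈ cycles G (W \ {v}), c ∉ boundaries G W := by
    intro z hz hzB hl
    obtain ⟨e, he, hez⟩ := hl
    obtain ⟨h1, h2⟩ := push_off hz he hez
    exact ⟨_, h1, fun hB => hzB (mem_of_add_mem_right
      (h2 ▸ bd_mem_boundaries (cone_mem_chains hv he)) hB)⟩
  obtain ⟨c, hc, hcB⟩ : ∃ c ∈ cycles G (W \ {v}), c ∉ boundaries G W := by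
    have := h.not_atMostOne
    unfold AtMostOne at this
    push Not at this
    obtain ⟨z, hz, z', hz', h1, h2, h3⟩ := this
    rcases h.link hv _ (linkPart_mem_cycles hz) _ (linkPart_mem_cycles hz') with hl | hl | hl
    · exact key z hz h1 hl
    · exact key z' hz' h2 hl
    · rw [← map_add] at hl
      exact key _ (add_mem hz hz') h3 hl
  by_contra! hno
  apply hcB
  rw [eq_sum_restr c]
  exact sum_mem fun j _ => hno _ (restr_mem_cycles hc) j homog_restr

/-- A homogeneous cycle avoiding `v` that does not bound. -/
noncomputable def rep (h : Critical G W) (v : W) : Chain V := (h.exists_rep v.2).choose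

/-- The degree of `rep`. -/
noncomputable def repDeg (h : Critical G W) (v : W) : ℕ :=
  (h.exists_rep v.2).choose_spec.2.choose

variable (h : Critical G W)

theorem rep_mem (v : W) : h.rep v ∈ cycles G (W \ {v.1}) := (h.exists_rep v.2).choose_spec.1

theorem homog_rep (v : W) : Homog (h.repDeg v) (h.rep v) :=
  (h.exists_rep v.2).choose_spec.2.choose_spec.1

theorem rep_notMem (v : W) : h.rep v ∉ boundaries G W :=
  (h.exists_rep v.2).choose_spec.2.choose_spec.2

theorem rep_mem_cycles (v : W) : h.rep v ∈ cycles G W :=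
  cycles_mono Set.sdiff_subset (h.rep_mem v)

theorem nz_diff (v : W) : Nz G (h.repDeg v) (W \ {v.1}) :=
  ⟨_, h.rep_mem v, h.homog_rep v, fun hB =>
    h.rep_notMem v (boundaries_mono Set.sdiff_subset hB)⟩

theorem mem_boundaries_or (v : W) (hz : z ∈ cycles G W)
    (hl : linkPart v.1 z ∈ boundaries G (lk G W v)) :
    z ∈ boundaries G W ∨ z + h.rep v ∈ boundaries G W := by
  obtain ⟨e, he, hez⟩ := hl
  obtain ⟨h1, h2⟩ := push_off hz he hez
  have h3 : z + (delPart v.1 z + e) ∈ boundaries G W :=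
    h2 ▸ bd_mem_boundaries (cone_mem_chains v.2 he)
  rcases h.diff v.2 _ h1 _ (h.rep_mem v) with h4 | h4 | h4
  · exact Or.inl (mem_of_add_mem_right h3 (boundaries_mono Set.sdiff_subset h4))
  · exact absurd (boundaries_mono Set.sdiff_subset h4) (h.rep_notMem v)
  · right
    have h5 := add_mem h3 (boundaries_mono Set.sdiff_subset h4)
    rwa [show ∀ a b c : Chain V, a + b + (b + c) = b + b + (a + c) by intros; abel,
      chain_add_self, zero_add] at h5

theorem exists_linkPart_notMem (h : Critical G W) (v : W) :
    ∃ z ∈ cycles G W, linkPart v.1 z ∉ boundaries G (lk G W v) := by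
  by_contra! hno
  apply h.not_atMostOne
  intro z hz z' hz'
  rcases h.mem_boundaries_or v hz (hno z hz) with h1 | h1
  · exact Or.inl h1
  rcases h.mem_boundaries_or v hz' (hno z' hz') with h2 | h2
  · exact Or.inr (Or.inl h2)
  · right; right
    have h5 := add_mem h1 h2
    rwa [show ∀ a b c : Chain V, a + b + (c + b) = b + b + (a + c) by intros; abel,
      chain_add_self, zero_add] at h5

theorem not_acyc_lk (h : Critical G W) (v : W) : ¬ Acyc G (lk G W v) := by
  obtain ⟨z, hz, hl⟩ := h.exists_linkPart_notMem v
  exact fun hA => hl (hA (linkPart_mem_cycles hz))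

/-- The degree of the homology of the link of `v`. -/
noncomputable def lkDeg (h : Critical G W) (v : W) : ℕ :=
  (exists_nz_of_not_acyc (h.not_acyc_lk v)).choose

theorem nz_lk (h : Critical G W) (v : W) : Nz G (h.lkDeg v) (lk G W v) :=
  (exists_nz_of_not_acyc (h.not_acyc_lk v)).choose_spec

/-- `u` and `v` have homologous representing cycles. -/
def Same (u v : W) : Prop := h.rep u + h.rep v ∈ boundaries G W

variable {h}

theorem Same.symm {u v : W} (huv : h.Same u v) : h.Same v u := by
  unfold Same at *
  rwa [add_comm]

theorem Same.trans {u v w : W} (huv : h.Same u v) (hvw : h.Same v w) : h.Same u w := by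
  have h5 := add_mem huv hvw
  rwa [show ∀ a b c : Chain V, a + b + (b + c) = b + b + (a + c) by intros; abel,
      chain_add_self, zero_add] at h5

theorem repDeg_eq_of_not_same {u v : W} (huv : ¬ h.Same u v) : h.repDeg u = h.lkDeg v + 1 := by
  have hl : linkPart v.1 (h.rep u) ∉ boundaries G (lk G W v) := by
    intro hl
    rcases h.mem_boundaries_or v (h.rep_mem_cycles u) hl with h1 | h1
    · exact h.rep_notMem u h1
    · exact huv h1
  have hom := h.homog_rep u
  rcases hd : h.repDeg u with _ | d
  · rw [hd] at hom
    rw [hom.linkPart_zero] at hl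
    exact absurd (zero_mem _) hl
  · rw [hd] at hom
    rw [(h.link v.2).degree_unique (h.nz_lk v)
      ⟨_, linkPart_mem_cycles (h.rep_mem_cycles u), hom.linkPart, hl⟩]

theorem exists_coloring (h : Critical G W) :
    ∃ κ : W → ZMod 3, ∀ u v, κ u = κ v ↔ h.Same u v := by
  rcases isEmpty_or_nonempty W with hW | ⟨⟨r⟩⟩
  · exact ⟨fun _ => 0, fun u => hW.elim u⟩
  obtain ⟨w, hw, hwl⟩ := h.exists_linkPart_notMem r
  have cases3 : ∀ v, h.rep v + h.rep r ∈ boundaries G W ∨ h.rep v + w ∈ boundaries G W ∨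
      h.rep v + (w + h.rep r) ∈ boundaries G W := by
    intro v
    have hv := h.rep_mem_cycles v
    rcases h.link r.2 _ (linkPart_mem_cycles hv) _ (linkPart_mem_cycles hw) with h1 | h1 | h1
    · exact Or.inl ((h.mem_boundaries_or r hv h1).resolve_left (h.rep_notMem v))
    · exact absurd h1 hwl
    · rw [← map_add] at h1
      rw [← add_assoc]
      exact Or.inr (h.mem_boundaries_or r (add_mem hv hw) h1)
  have join : ∀ u v y, h.rep u + y ∈ boundaries G W → h.rep v + y ∈ boundaries G W →
      h.Same u v := by
    intro u v y hu hv
    have h5 := add_mem hu hv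
    rwa [show ∀ a b c : Chain V, a + b + (c + b) = b + b + (a + c) by intros; abel,
      chain_add_self, zero_add] at h5
  have move : ∀ u v y, h.Same u v → h.rep u + y ∈ boundaries G W →
      h.rep v + y ∈ boundaries G W := by
    intro u v y huv hu
    have h5 := add_mem huv hu
    rwa [show ∀ a b c : Chain V, a + b + (a + c) = a + a + (b + c) by intros; abel,
      chain_add_self, zero_add] at h5
  refine ⟨fun v => if h.rep v + h.rep r ∈ boundaries G W then 0 else
    if h.rep v + w ∈ boundaries G W then 1 else 2, fun u v => ⟨fun huv => ?_, fun huv => ?_⟩⟩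
  · dsimp only at huv
    rcases cases3 u with hu | hu | hu <;> rcases cases3 v with hv | hv | hv <;>
      first
      | exact join _ _ _ hu hv
      | (split_ifs at huv <;> first
          | exact join _ _ _ ‹_› ‹_›
          | exact absurd huv (by decide))
  · have e1 : ∀ y, h.rep u + y ∈ boundaries G W ↔ h.rep v + y ∈ boundaries G W :=
      fun y => ⟨move u v y huv, move v u y huv.symm⟩
    simp only [e1]

end Critical

end

section

namespace Critical

variable {G : SimpleGraph V} {W : Set V} {h : Critical G W} {a b : W}

theorem not_acyc_diff (h : Critical G W) (v : W) : ¬ Acyc G (W \ {v.1}) := (h.nz_diff v).not_acyc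

theorem Same.not_acyc_diff_diff (hab : h.Same a b) (hne : a ≠ b)
    (hor : G.Adj a b ∨ Acyc G (lk G (lk G W a) b)) : ¬ Acyc G ((W \ {a.1}) \ {b.1}) := by
  intro hA
  obtain ⟨y, hy, hyB⟩ := exists_cycle_avoiding_both a.2 b.2 (fun h' => hne (Subtype.ext h'))
    (h.rep_mem a) (h.rep_mem b) hab hor
  exact h.rep_notMem a (boundaries_mono Set.sdiff_subset
    (mem_of_add_mem_right hyB (boundaries_mono Set.sdiff_subset (hA hy))))

theorem Same.not_adj (hab : h.Same a b) : ¬ G.Adj a b := by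
  intro hadj
  have hne : b.1 ≠ a.1 := hadj.ne'
  rcases h.acyc_or (Set.sdiff_singleton_ssubset.2 a.2) (v := b.1) ⟨b.2, hne⟩ with h1 | h1 | h1
  · exact h.not_acyc_diff a h1
  · exact hab.not_acyc_diff_diff (fun h' => hne (congrArg _ h'.symm)) (Or.inl hadj) h1
  · rw [lk_diff_of_adj hadj] at h1
    exact h.not_acyc_lk b h1

theorem Same.acyc_lk_diff (hab : h.Same a b) (hne : a ≠ b) : Acyc G (lk G (W \ {b.1}) a) := by
  by_contra hA
  have hne' : a.1 ≠ b.1 := fun h' => hne (Subtype.ext h')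
  have h1 : Acyc G ((W \ {b.1}) \ {a.1}) :=
    ((h.acyc_or (Set.sdiff_singleton_ssubset.2 b.2) (v := a.1) ⟨a.2, hne'⟩).resolve_left
      (h.not_acyc_diff b)).resolve_right hA
  rw [lk_diff_comm] at hA
  have h2 : Acyc G (lk G (lk G W a) b) :=
    ((h.acyc_or (lk_subset_diff.trans_ssubset (Set.sdiff_singleton_ssubset.2 a.2)) (v := b.1)
      ⟨b.2, hne'.symm, hab.not_adj⟩).resolve_left (h.not_acyc_lk a)).resolve_left hA
  rw [diff_diff_singleton_comm] at h1
  exact hab.not_acyc_diff_diff hne (Or.inr h2) h1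

theorem Same.repDeg_eq (hab : h.Same a b) : h.repDeg a = h.repDeg b := by
  by_cases hne : a = b
  · rw [hne]
  have hne' : a.1 ≠ b.1 := fun h' => hne (Subtype.ext h')
  have hb : b.1 ∈ W \ {a.1} := ⟨b.2, hne'.symm⟩
  have ha : a.1 ∈ W \ {b.1} := ⟨a.2, hne'⟩
  have h1 := h.nz_diff a
  rw [nz_iff_diff hb (hab.symm.acyc_lk_diff (Ne.symm hne)),
    diff_diff_singleton_comm, ← nz_iff_diff ha (hab.acyc_lk_diff hne)] at h1
  exact (h.diff b.2).degree_unique h1 (h.nz_diff b)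

theorem Same.lkDeg_eq (hab : h.Same a b) : h.lkDeg a = h.lkDeg b := by
  by_cases hne : a = b
  · rw [hne]
  have hne' : a.1 ≠ b.1 := fun h' => hne (Subtype.ext h')
  have hA := hab.acyc_lk_diff hne
  have hB := hab.symm.acyc_lk_diff (Ne.symm hne)
  rw [lk_diff_comm] at hA hB
  have hb : b.1 ∈ lk G W a := ⟨b.2, hne'.symm, hab.not_adj⟩
  have ha : a.1 ∈ lk G W b := ⟨a.2, hne', hab.symm.not_adj⟩
  rcases (h.nz_lk a).of_self hb with h1 | ⟨i, hi, h1⟩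
  · exact absurd hA h1.not_acyc
  · rw [lk_lk_comm, nz_lk_iff ha hB, ← hi] at h1
    exact (h.link b.2).degree_unique h1 (h.nz_lk b)

end Critical

/-- The vertices of `W` outside `Q` that are neither in `P` nor adjacent to `P`. -/
def resid (G : SimpleGraph V) (W : Set V) (P Q : Finset V) : Set V :=
  {x | x ∈ W ∧ x ∉ Q ∧ ∀ p ∈ P, x ≠ p ∧ ¬ G.Adj p x}

section resid

variable {G : SimpleGraph V} {W : Set V} {P Q S : Finset V} {a b y : V} {j k m p : ℕ}

theorem resid_subset : resid G W P Q ⊆ W := fun _ hx => hx.1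

theorem resid_diff : resid G W P Q \ {y} = resid G W P (insert y Q) := by
  ext x
  simp only [resid, Set.mem_sdiff, Set.mem_ofPred_eq, Set.mem_singleton_iff, Finset.mem_insert]
  tauto

theorem lk_resid : lk G (resid G W P Q) y = resid G W (insert y P) Q := by
  ext x
  simp only [resid, mem_lk, Set.mem_ofPred_eq, Finset.forall_mem_insert]
  tauto

theorem resid_empty_singleton : resid G W ∅ {a} = W \ {a} := by
  ext x
  simp [resid]

theorem resid_singleton_empty : resid G W {a} ∅ = lk G W a := by
  ext x
  simp only [resid, mem_lk, Set.mem_ofPred_eq, Finset.mem_singleton, forall_eq,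
    Finset.notMem_empty, not_false_eq_true]
  tauto

theorem resid_singleton_singleton : resid G W {a} {b} = lk G (W \ {b}) a := by
  ext x
  simp only [resid, mem_lk, Set.mem_ofPred_eq, Finset.mem_singleton, forall_eq, Set.mem_sdiff,
    Set.mem_singleton_iff]
  tauto

theorem mem_resid (hy : y ∈ W) (hP : y ∉ P) (hQ : y ∉ Q) (h : ∀ p ∈ P, ¬ G.Adj p y) :
    y ∈ resid G W P Q :=
  ⟨hy, hQ, fun p hp => ⟨fun h' => hP (h' ▸ hp), h p hp⟩⟩

theorem resid_ssubset (hy : y ∈ W) (h : y ∈ P ∨ y ∈ Q) : resid G W P Q ⊂ W :=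
  ⟨resid_subset, fun hsub => by
    rcases h with h | h
    · exact ((hsub hy).2.2 y h).1 rfl
    · exact (hsub hy).2.1 h⟩

/-- A set of vertices of a critical set behaving as a class of vertices with homologous
representing cycles of large degree. -/
structure HomologyClass (G : SimpleGraph V) (W : Set V) (S : Finset V) (p k : ℕ) : Prop where
  mem : ∀ a ∈ S, a ∈ W
  not_adj : ∀ a ∈ S, ∀ b ∈ S, ¬ G.Adj a b
  nz_diff : ∀ a ∈ S, Nz G p (W \ {a})
  nz_lk : ∀ a ∈ S, Nz G k (lk G W a)
  acyc : ∀ a ∈ S, ∀ b ∈ S, a ≠ b → Acyc G (lk G (W \ {b}) a)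
  lt : k < p

/-- All the mixed residues of size `m` are acyclic. -/
def AcycMixed (G : SimpleGraph V) (W : Set V) (S : Finset V) (m : ℕ) : Prop :=
  ∀ P Q, P ⊆ S → Q ⊆ S → Disjoint P Q → P.Nonempty → Q.Nonempty → P.card + Q.card = m →
    Acyc G (resid G W P Q)

namespace HomologyClass

theorem mem_resid (hS : HomologyClass G W S p k) (hP : P ⊆ S) (hy : y ∈ S)
    (hyP : y ∉ P) (hyQ : y ∉ Q) : y ∈ resid G W P Q :=
  IndependenceComplex.mem_resid (hS.mem y hy) hyP hyQ fun q hq => hS.not_adj q (hP hq) y hy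

theorem nz_move (hS : HomologyClass G W S p k) (hm : AcycMixed G W S m)
    (hP : P ⊆ S) (hQ : Q ⊆ S) (hPQ : Disjoint P Q)
    (hy : y ∈ S) (hyP : y ∉ P) (hyQ : y ∉ Q) (hP0 : P.Nonempty) (hQ0 : Q.Nonempty)
    (hc : P.card + Q.card = m) :
    Nz G j (resid G W (insert y P) Q) ↔ Nz G j (resid G W P (insert y Q)) := by
  rw [← lk_resid, ← resid_diff]
  exact nz_lk_iff_diff (hS.mem_resid hP hy hyP hyQ) (hm P Q hP hQ hPQ hP0 hQ0 hc)

theorem exists_singleton_left (hS : HomologyClass G W S p k) (hm : AcycMixed G W S m)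
    (hP : P ⊆ S) (hQ : Q ⊆ S) (hPQ : Disjoint P Q) (hP0 : P.Nonempty) (hQ0 : Q.Nonempty)
    (hc : P.card + Q.card = m + 1)
    (h : Nz G j (resid G W P Q)) :
    ∃ a ∈ S, ∃ Q' ⊆ S, a ∉ Q' ∧ Q'.card = m ∧ Nz G j (resid G W {a} Q') := by
  induction hP0 using Finset.Nonempty.cons_induction generalizing Q with
  | singleton a =>
    refine ⟨a, by simpa using hP, Q, hQ, by simpa using hPQ, ?_, h⟩
    rw [Finset.card_singleton] at hc
    omega
  | cons a P ha hP0 ih =>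
    rw [Finset.cons_eq_insert] at *
    rw [Finset.insert_subset_iff] at hP
    rw [Finset.disjoint_insert_left] at hPQ
    rw [Finset.card_insert_of_notMem ha] at hc
    refine ih hP.2 (Finset.insert_subset hP.1 hQ) ?_ (Finset.insert_nonempty a Q) ?_ ?_
    · exact Finset.disjoint_insert_right.2 ⟨ha, hPQ.2⟩
    · rw [Finset.card_insert_of_notMem hPQ.1]
      omega
    · exact (hS.nz_move hm hP.2 hQ hPQ.2 hP.1 ha hPQ.1 hP0 hQ0 (by omega)).1 h

theorem exists_singleton_right (hS : HomologyClass G W S p k) (hm : AcycMixed G W S m)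
    (hP : P ⊆ S) (hQ : Q ⊆ S) (hPQ : Disjoint P Q) (hP0 : P.Nonempty) (hQ0 : Q.Nonempty)
    (hc : P.card + Q.card = m + 1)
    (h : Nz G j (resid G W P Q)) :
    ∃ b ∈ S, ∃ P' ⊆ S, b ∉ P' ∧ P'.card = m ∧ Nz G j (resid G W P' {b}) := by
  induction hQ0 using Finset.Nonempty.cons_induction generalizing P with
  | singleton a =>
    refine ⟨a, by simpa using hQ, P, hP, by simpa using hPQ, ?_, h⟩
    rw [Finset.card_singleton] at hc
    omega
  | cons a Q ha hQ0 ih =>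
    rw [Finset.cons_eq_insert] at *
    rw [Finset.insert_subset_iff] at hQ
    rw [Finset.disjoint_insert_right] at hPQ
    rw [Finset.card_insert_of_notMem ha] at hc
    refine ih (Finset.insert_subset hQ.1 hP) hQ.2 ?_ (Finset.insert_nonempty a P) ?_ ?_
    · exact Finset.disjoint_insert_left.2 ⟨ha, hPQ.2⟩
    · rw [Finset.card_insert_of_notMem hPQ.1]
      omega
    · exact (hS.nz_move hm hP hQ.2 hPQ.2 hQ.1 hPQ.1 ha hP0 hQ0 (by omega)).2 h

theorem acycMixed_succ (hS : HomologyClass G W S p k) (hW : Critical G W)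
    (hm2 : 2 ≤ m) (hm : AcycMixed G W S m)
    (hJ : ∀ Q ⊆ S, Q.card = m → Nz G p (resid G W ∅ Q))
    (hK : ∀ P ⊆ S, P.card = m → ∃ j, j + m = k + 1 ∧ Nz G j (resid G W P ∅)) :
    AcycMixed G W S (m + 1) := by
  intro P Q hP hQ hPQ hP0 hQ0 hc
  by_contra hA
  obtain ⟨j, hj⟩ := exists_nz_of_not_acyc hA
  obtain ⟨a, ha, Q', hQ', haQ', hQm, hnzQ⟩ :=
    hS.exists_singleton_left hm hP hQ hPQ hP0 hQ0 hc hj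
  obtain ⟨b, hb, P', hP', hbP', hPm, hnzP⟩ :=
    hS.exists_singleton_right hm hP hQ hPQ hP0 hQ0 hc hj
  obtain ⟨q, hq⟩ : Q'.Nonempty := Finset.card_pos.1 (by omega)
  obtain ⟨r, hr⟩ : P'.Nonempty := Finset.card_pos.1 (by omega)
  have hpj : p = j + 1 := by
    have hsub : resid G W ∅ Q' ⊂ W := resid_ssubset (hS.mem q (hQ' hq)) (Or.inr hq)
    have hmem : a ∈ resid G W ∅ Q' :=
      hS.mem_resid (Finset.empty_subset S) ha (Finset.notMem_empty a) haQ'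
    have hlk : lk G (resid G W ∅ Q') a = resid G W {a} Q' := lk_resid
    have hD := ((hW.acyc_or hsub hmem).resolve_left (hJ Q' hQ' hQm).not_acyc).resolve_right
      (hlk ▸ hnzQ.not_acyc)
    rw [← hlk, nz_lk_iff hmem hD] at hnzQ
    exact (hW.proper _ hsub).degree_unique (hJ Q' hQ' hQm) hnzQ
  obtain ⟨j', hj', hnz'⟩ := hK P' hP' hPm
  have hjj : j' = j := by
    have hsub : resid G W P' ∅ ⊂ W := resid_ssubset (hS.mem r (hP' hr)) (Or.inl hr)
    have hmem : b ∈ resid G W P' ∅ := hS.mem_resid hP' hb hbP' (Finset.notMem_empty b)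
    have hD : resid G W P' ∅ \ {b} = resid G W P' {b} := resid_diff
    have hA' := ((hW.acyc_or hsub hmem).resolve_left hnz'.not_acyc).resolve_left
      (hD ▸ hnzP.not_acyc)
    rw [← hD, ← nz_iff_diff hmem hA'] at hnzP
    exact (hW.proper _ hsub).degree_unique hnz' hnzP
  have := hS.lt
  omega

theorem nz_resid_aux (hS : HomologyClass G W S p k) (hW : Critical G W) (m : ℕ) :
    AcycMixed G W S (m + 1) ∧
    (∀ Q ⊆ S, Q.card = m + 1 → Nz G p (resid G W ∅ Q)) ∧
    ∀ P ⊆ S, P.card = m + 1 → ∃ j, j + (m + 1) = k + 1 ∧ Nz G j (resid G W P ∅) := by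
  induction m with
  | zero =>
    refine ⟨fun P Q _ _ _ hP0 hQ0 hc => ?_, fun Q hQ hc => ?_, fun P hP hc => ?_⟩
    · have := hP0.card_pos
      have := hQ0.card_pos
      omega
    · obtain ⟨a, rfl⟩ := Finset.card_eq_one.1 hc
      rw [resid_empty_singleton]
      exact hS.nz_diff a (by simpa using hQ)
    · obtain ⟨a, rfl⟩ := Finset.card_eq_one.1 hc
      rw [resid_singleton_empty]
      exact ⟨k, rfl, hS.nz_lk a (by simpa using hP)⟩
  | succ m ih =>
    obtain ⟨ihI, ihJ, ihK⟩ := ih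
    have hI : AcycMixed G W S (m + 1 + 1) := by
      rcases m with _ | m
      · intro P Q hP hQ hPQ hP0 hQ0 hc
        have := hP0.card_pos
        have := hQ0.card_pos
        obtain ⟨a, rfl⟩ := Finset.card_eq_one.1 (show P.card = 1 by omega)
        obtain ⟨b, rfl⟩ := Finset.card_eq_one.1 (show Q.card = 1 by omega)
        rw [resid_singleton_singleton]
        exact hS.acyc a (by simpa using hP) b (by simpa using hQ) (by simpa using hPQ)
      · exact hS.acycMixed_succ hW (by omega) ihI ihJ ihK
    refine ⟨hI, fun Q hQ hc => ?_, fun P hP hc => ?_⟩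
    · obtain ⟨y, Q, hyQ, rfl, hc'⟩ := Finset.card_eq_succ.1 hc
      rw [Finset.insert_subset_iff] at hQ
      rw [← resid_diff, ← nz_iff_diff
        (hS.mem_resid (Finset.empty_subset S) hQ.1 (Finset.notMem_empty y) hyQ)]
      · exact ihJ Q hQ.2 hc'
      · rw [lk_resid]
        refine hI _ Q ?_ hQ.2 ?_ (Finset.insert_nonempty y ∅) (Finset.card_pos.1 (by omega)) ?_
        · simpa using hQ.1
        · simpa using hyQ
        · simp [hc', add_comm]
    · obtain ⟨y, P, hyP, rfl, hc'⟩ := Finset.card_eq_succ.1 hc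
      rw [Finset.insert_subset_iff] at hP
      obtain ⟨j, hj, hnz⟩ := ihK P hP.2 hc'
      have hA : Acyc G (resid G W P ∅ \ {y}) := by
        rw [resid_diff]
        refine hI P _ hP.2 ?_ ?_ (Finset.card_pos.1 (by omega)) (Finset.insert_nonempty y ∅) ?_
        · simpa using hP.1
        · simpa using hyP
        · simp [hc']
      rcases hnz.of_self (hS.mem_resid hP.2 hP.1 hyP (Finset.notMem_empty y)) with h1 | ⟨i, hi, h1⟩
      · exact absurd hA h1.not_acyc
      · rw [lk_resid] at h1
        exact ⟨i, by omega, h1⟩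

theorem nz_resid (hS : HomologyClass G W S p k) (hW : Critical G W) (h0 : S.Nonempty) :
    Nz G p (resid G W ∅ S) := by
  obtain ⟨m, hm⟩ := Nat.exists_eq_add_one_of_ne_zero h0.card_pos.ne'
  exact (hS.nz_resid_aux hW m).2.1 S subset_rfl hm

end HomologyClass

end resid

namespace Critical

variable {G : SimpleGraph V} {W : Set V}

theorem not_acyc (h : Critical G W) : ¬ Acyc G W := fun hA =>
  h.not_atMostOne fun _ hz _ _ => Or.inl (hA hz)

theorem repDeg_le_lkDeg (h : Critical G W) (n v : W) (hnv : G.Adj n v)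
    (hN : ∀ u : W, G.Adj n u → h.Same v u) : h.repDeg v ≤ h.lkDeg v := by
  by_contra! hlt
  let S : Finset V := Finset.univ.filter fun x => x ∈ W ∧ G.Adj n x
  have hS : ∀ x ∈ S, ∃ hx : x ∈ W, h.Same v ⟨x, hx⟩ := fun x hx =>
    ⟨(Finset.mem_filter.1 hx).2.1, hN ⟨x, _⟩ (Finset.mem_filter.1 hx).2.2⟩
  have hclass : HomologyClass G W S (h.repDeg v) (h.lkDeg v) :=
    { mem := fun a ha => (hS a ha).1
      not_adj := fun a ha b hb => by
        obtain ⟨ha, ha'⟩ := hS a ha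
        obtain ⟨hb, hb'⟩ := hS b hb
        exact (ha'.symm.trans hb').not_adj
      nz_diff := fun a ha => by
        obtain ⟨ha, ha'⟩ := hS a ha
        exact ha'.repDeg_eq ▸ h.nz_diff ⟨a, ha⟩
      nz_lk := fun a ha => by
        obtain ⟨ha, ha'⟩ := hS a ha
        exact ha'.lkDeg_eq ▸ h.nz_lk ⟨a, ha⟩
      acyc := fun a ha b hb hab => by
        obtain ⟨ha, ha'⟩ := hS a ha
        obtain ⟨hb, hb'⟩ := hS b hb
        exact (ha'.symm.trans hb').acyc_lk_diff fun h' => hab (congrArg Subtype.val h')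
      lt := hlt }
  have hv : v.1 ∈ S := Finset.mem_filter.2 ⟨Finset.mem_univ _, v.2, hnv⟩
  refine (hclass.nz_resid h ⟨v, hv⟩).not_acyc (acyc_of_isolated (v := n.1) ?_ ?_)
  · exact ⟨n.2, fun hn => G.irrefl (Finset.mem_filter.1 hn).2.2, by simp⟩
  · exact fun x hx hadj => hx.2.1 (Finset.mem_filter.2 ⟨Finset.mem_univ x, hx.1, hadj⟩)

theorem exists_adj (h : Critical G W) (v : W) : ∃ n : W, G.Adj v n := by
  by_contra! hno
  exact h.not_acyc (acyc_of_isolated v.2 fun x hx => hno ⟨x, hx⟩)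

theorem exists_adj_not_same (h : Critical G W) (v : W) :
    ∃ m n : W, G.Adj v m ∧ G.Adj v n ∧ ¬ h.Same m n := by
  by_contra! hno
  obtain ⟨n, hn⟩ := h.exists_adj v
  have h1 := h.repDeg_le_lkDeg v n hn fun u hu => hno n u hn hu
  have h2 : ¬ h.Same v n := fun hs => hs.not_adj hn
  have h3 := repDeg_eq_of_not_same h2
  have h4 := repDeg_eq_of_not_same fun hs : h.Same n v => h2 hs.symm
  have h5 := h.repDeg_le_lkDeg n v hn.symm fun u hu => by
    by_contra hs
    have h6 := repDeg_eq_of_not_same fun hs' : h.Same u n => hs'.symm.not_adj hu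
    have h7 := repDeg_eq_of_not_same fun hs' : h.Same u v => hs hs'.symm
    omega
  omega

theorem exists_coloring_adj (h : Critical G W) : ∃ κ : W → ZMod 3,
    (∀ u v : W, G.Adj u v → κ u ≠ κ v) ∧ ∀ v : W, ∃ w : W, G.Adj v w ∧ κ w = κ v + 1 := by
  obtain ⟨κ, hκ⟩ := h.exists_coloring
  refine ⟨κ, fun u v huv he => ((hκ u v).1 he).not_adj huv, fun v => ?_⟩
  obtain ⟨m, n, hm, hn, hmn⟩ := h.exists_adj_not_same v
  have h1 : κ m ≠ κ n := fun he => hmn ((hκ m n).1 he)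
  have h2 : κ v ≠ κ m := fun he => ((hκ v m).1 he).not_adj hm
  have h3 : κ v ≠ κ n := fun he => ((hκ v n).1 he).not_adj hn
  have key : ∀ x y z : ZMod 3, x ≠ y → z ≠ x → z ≠ y → x = z + 1 ∨ y = z + 1 := by decide
  rcases key _ _ _ h1 h2 h3 with he | he
  · exact ⟨m, hm, he⟩
  · exact ⟨n, hn, he⟩

end Critical

end

section

section Coloring

variable {U : Type*} {H : SimpleGraph U} {κ : U → ZMod 3} {g : ℕ → U} {n : ℕ}

/-- `g` walks around `H` in `n` steps, increasing the color by one at each step. -/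
def IsRainbowWalk (H : SimpleGraph U) (κ : U → ZMod 3) (g : ℕ → U) (n : ℕ) : Prop :=
  0 < n ∧ g n = g 0 ∧ ∀ i < n, H.Adj (g i) (g (i + 1)) ∧ κ (g (i + 1)) = κ (g i) + 1

theorem exists_isRainbowWalk [Finite U] [Nonempty U]
    (h : ∀ v, ∃ w, H.Adj v w ∧ κ w = κ v + 1) : ∃ n g, IsRainbowWalk H κ g n := by
  choose f hf using h
  obtain ⟨v⟩ := ‹Nonempty U›
  obtain ⟨i, j, hij, he⟩ : ∃ i j, i < j ∧ f^[i] v = f^[j] v := by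
    obtain ⟨i, j, hne, he⟩ := Finite.exists_ne_map_eq_of_infinite fun i : ℕ => f^[i] v
    rcases lt_or_gt_of_ne hne with hlt | hlt
    · exact ⟨i, j, hlt, he⟩
    · exact ⟨j, i, hlt, he.symm⟩
  refine ⟨j - i, fun t => f^[i + t] v, by omega, ?_, fun t _ => ?_⟩
  · dsimp only
    rw [Nat.add_sub_cancel' hij.le, add_zero, he]
  · dsimp only
    rw [← add_assoc, Function.iterate_succ_apply']
    exact hf _

theorem IsRainbowWalk.color_eq (hg : IsRainbowWalk H κ g n) {i : ℕ} (hi : i ≤ n) :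
    κ (g i) = κ (g 0) + i := by
  induction i with
  | zero => simp
  | succ i ih => rw [(hg.2.2 i (by omega)).2, ih (by omega), Nat.cast_succ, add_assoc]

theorem IsRainbowWalk.three_dvd (hg : IsRainbowWalk H κ g n) : 3 ∣ n := by
  have := hg.color_eq le_rfl
  rw [hg.2.1, left_eq_add] at this
  exact (ZMod.natCast_eq_zero_iff n 3).1 this

/-- A shortest rainbow closed walk is an induced cycle. -/
theorem IsRainbowWalk.nonempty_embedding (hg : IsRainbowWalk H κ g n)
    (hmin : ∀ m g', IsRainbowWalk H κ g' m → n ≤ m) (hκ : ∀ u v, H.Adj u v → κ u ≠ κ v) :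
    Nonempty (SimpleGraph.cycleGraph n ↪g H) := by
  have h3 : 3 ≤ n := Nat.le_of_dvd hg.1 hg.three_dvd
  have hinj : ∀ i j, i < j → j < n → g i ≠ g j := by
    intro i j hij hj he
    have : IsRainbowWalk H κ (fun t => g (i + t)) (j - i) := by
      refine ⟨by omega, ?_, fun t ht => hg.2.2 (i + t) (by omega)⟩
      dsimp only
      rw [Nat.add_sub_cancel' hij.le, add_zero, he]
    have := hmin _ _ this
    omega
  have hchord : ∀ i j, i < j → j < n → H.Adj (g i) (g j) → j = i + 1 ∨ j = i + (n - 1) := by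
    intro i j hij hj hadj
    have hcol : κ (g j) = κ (g i) + (j - i : ℕ) := by
      rw [hg.color_eq hj.le, hg.color_eq (hij.trans hj).le, add_assoc, ← Nat.cast_add,
        Nat.add_sub_cancel' hij.le]
    have hcases : ∀ x : ZMod 3, x = 0 ∨ x = 1 ∨ x + 1 = 0 := by decide
    rcases hcases (j - i : ℕ) with hx | hx | hx
    · rw [hx, add_zero] at hcol
      exact absurd hcol.symm (hκ _ _ hadj)
    · left
      have : IsRainbowWalk H κ (fun t => if t ≤ i then g t else g (t + (j - i - 1)))
          (n - (j - i - 1)) := by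
        refine ⟨by omega, ?_, fun t ht => ?_⟩
        · dsimp only
          rw [if_neg (by omega), if_pos (Nat.zero_le i), Nat.sub_add_cancel (by omega), hg.2.1]
        · dsimp only
          rcases lt_trichotomy t i with hti | rfl | hti
          · rw [if_pos hti.le, if_pos (Nat.succ_le_of_lt hti)]
            exact hg.2.2 t (by omega)
          · rw [if_pos le_rfl, if_neg (by omega), show t + 1 + (j - t - 1) = j by omega, hcol, hx]
            exact ⟨hadj, rfl⟩
          · rw [if_neg (by omega), if_neg (by omega), add_right_comm]
            exact hg.2.2 _ (by omega)
      have := hmin _ _ this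
      omega
    · right
      have : IsRainbowWalk H κ (fun t => if t ≤ j - i then g (i + t) else g i) (j - i + 1) := by
        refine ⟨by omega, ?_, fun t ht => ?_⟩
        · simp
        · dsimp only
          rcases (Nat.lt_succ_iff.1 ht).lt_or_eq with hti | rfl
          · rw [if_pos hti.le, if_pos (Nat.succ_le_of_lt hti)]
            exact hg.2.2 _ (by omega)
          · rw [if_pos le_rfl, if_neg (by omega), Nat.add_sub_cancel' hij.le, hcol, add_assoc, hx,
              add_zero]
            exact ⟨hadj.symm, rfl⟩
      have := hmin _ _ this
      omega
  have hne : ∀ u v : Fin n, u < v →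
      ((SimpleGraph.cycleGraph n).Adj u v ↔ H.Adj (g u) (g v)) := by
    intro u v huv
    have huv' : u.1 < v.1 := huv
    have hv := v.2
    rw [SimpleGraph.cycleGraph_adj', Fin.sub_val_of_le huv.le, Fin.coe_sub_iff_lt.2 huv]
    constructor
    · rintro (h1 | h1)
      · have hu0 : u.1 = 0 := by omega
        have hv1 : v.1 + 1 = n := by omega
        have := (hg.2.2 v.1 hv).1.symm
        rwa [hv1, hg.2.1, ← hu0] at this
      · have hv1 : v.1 = u.1 + 1 := by omega
        rw [hv1]
        exact (hg.2.2 u.1 (by omega)).1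
    · intro hadj
      rcases hchord u v huv' hv hadj with h1 | h1 <;> omega
  refine ⟨⟨⟨fun i => g i, fun u v he => ?_⟩, fun {u v} => ?_⟩⟩
  · by_contra huv
    rcases lt_or_gt_of_ne huv with hlt | hlt
    · exact hinj u v hlt v.2 he
    · exact hinj v u hlt u.2 he.symm
  · change H.Adj (g u) (g v) ↔ _
    rcases lt_trichotomy u v with hlt | rfl | hlt
    · exact (hne u v hlt).symm
    · exact ⟨fun h => absurd h H.irrefl, fun h => absurd h (SimpleGraph.irrefl _)⟩
    · rw [H.adj_comm, (SimpleGraph.cycleGraph n).adj_comm]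
      exact (hne v u hlt).symm

theorem exists_cycleGraph_embedding [Finite U] [Nonempty U]
    (hκ : ∀ u v, H.Adj u v → κ u ≠ κ v) (h : ∀ v, ∃ w, H.Adj v w ∧ κ w = κ v + 1) :
    ∃ n, 3 ≤ n ∧ 3 ∣ n ∧ Nonempty (SimpleGraph.cycleGraph n ↪g H) := by
  have hex := exists_isRainbowWalk h
  obtain ⟨g, hg⟩ := Nat.find_spec hex
  exact ⟨_, Nat.le_of_dvd hg.1 hg.three_dvd, hg.three_dvd,
    hg.nonempty_embedding (fun m g' hg' => Nat.find_min' hex ⟨g', hg'⟩) hκ⟩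

end Coloring

variable {G : SimpleGraph V}

theorem Critical.not_ternary {W : Set V} (h : Critical G W) : ¬ Ternary G := by
  intro hG
  obtain ⟨κ, hκ, hw⟩ := h.exists_coloring_adj
  have hne : Nonempty W := by
    by_contra hemp
    refine h.not_atMostOne fun z hz z' hz' => ?_
    have key : ∀ y ∈ cycles G W, ∀ A ≠ ∅, y A = 0 := by
      intro y hy A hA
      by_contra hyA
      obtain ⟨x, hx⟩ := Finset.nonempty_iff_ne_empty.2 hA
      exact hemp ⟨⟨x, (hy.1 A hyA).2 hx⟩⟩
    have hcases : ∀ s t : ZMod 2, s = 0 ∨ t = 0 ∨ s + t = 0 := by decide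
    have hzero : ∀ y ∈ cycles G W, y ∅ = 0 → y ∈ boundaries G W := by
      intro y hy hy0
      have : y = 0 := by
        ext A
        by_cases hA : A = ∅
        · rw [hA, hy0]
          rfl
        · exact key y hy A hA
      rw [this]
      exact zero_mem _
    rcases hcases (z ∅) (z' ∅) with h1 | h1 | h1
    · exact Or.inl (hzero z hz h1)
    · exact Or.inr (Or.inl (hzero z' hz' h1))
    · exact Or.inr (Or.inr (hzero _ (add_mem hz hz') h1))
  obtain ⟨n, hn3, hn, ⟨e⟩⟩ := exists_cycleGraph_embedding (H := G.induce W) (κ := κ)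
    (fun u v huv => hκ u v huv) hw
  exact (hG n hn3 hn).false (e.trans (SimpleGraph.Embedding.induce W))

theorem atMostOne_of_ternary (hG : Ternary G) (W : Set V) : AtMostOne G W := by
  induction W using WellFoundedLT.induction with
  | ind W ih =>
    by_contra hW
    exact Critical.not_ternary ⟨hW, ih⟩ hG

end

section

/-- The stable sets of `G` whose cardinality satisfies `q`. -/
noncomputable def faces (G : SimpleGraph V) (q : ℕ → Prop) : Finset (Finset V) :=
  Finset.univ.filter fun A => Stable G A ∧ q A.card

/-- The chains supported on the stable sets of `G` whose cardinality satisfies `q`. -/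
def chainsWith (G : SimpleGraph V) (q : ℕ → Prop) : Submodule (ZMod 2) (Chain V) where
  carrier := {c | ∀ A ∉ faces G q, c A = 0}
  add_mem' {a b} ha hb A h := by simp [ha A h, hb A h]
  zero_mem' A _ := rfl
  smul_mem' r c hc A h := by simp [hc A h]

variable {G : SimpleGraph V} {q q' : ℕ → Prop} {c z : Chain V}

theorem mem_faces {A : Finset V} : A ∈ faces G q ↔ Stable G A ∧ q A.card := by simp [faces]

theorem chainsWith_le : chainsWith G q ≤ chains G Set.univ := by
  intro c hc A hA
  by_contra h
  exact hA (hc A fun h' => h ⟨(mem_faces.1 h').1, Set.subset_univ _⟩)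

theorem restr_mem_chainsWith (hc : c ∈ chains G Set.univ) : restr q c ∈ chainsWith G q := by
  intro A hA
  rw [restr_apply]
  split_ifs with h
  · by_contra hne
    exact hA (mem_faces.2 ⟨(hc A hne).1, h⟩)
  · rfl

theorem restr_eq_self (hc : c ∈ chainsWith G q) : restr q c = c := by
  ext A
  rw [restr_apply]
  split_ifs with h
  · rfl
  · exact (hc A fun h' => h (mem_faces.1 h').2).symm

theorem bd_mem_chainsWith (hq : ∀ n, q' (n + 1) ↔ q n) (hc : c ∈ chainsWith G q') :
    bd c ∈ chainsWith G q := by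
  rw [← restr_eq_self hc, bd_restr]
  simp only [hq]
  exact restr_mem_chainsWith (bd_mem_chains (chainsWith_le hc))

theorem finrank_chainsWith : Module.finrank (ZMod 2) (chainsWith G q) = (faces G q).card := by
  let e : chainsWith G q ≃ₗ[ZMod 2] (faces G q → ZMod 2) :=
    { toFun := fun c A => c.1 A.1
      map_add' := fun _ _ => rfl
      map_smul' := fun _ _ => rfl
      invFun := fun f => ⟨fun A => if h : A ∈ faces G q then f ⟨A, h⟩ else 0,
        fun A hA => dif_neg hA⟩
      left_inv := fun c => by
        ext A
        by_cases h : A ∈ faces G q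
        · simp [h]
        · simp [h, c.2 A h]
      right_inv := fun f => by
        ext A
        simp }
  rw [e.finrank_eq, Module.finrank_fintype_fun_eq_card, Fintype.card_coe]

theorem card_faces : (faces G q).card =
    Module.finrank (ZMod 2) ((chainsWith G q).map bd) +
      Module.finrank (ZMod 2)
        (chainsWith G q ⊓ LinearMap.ker bd : Submodule (ZMod 2) (Chain V)) := by
  rw [← finrank_chainsWith, ← (bd.domRestrict (chainsWith G q)).finrank_range_add_finrank_ker,
    LinearMap.range_domRestrict, LinearMap.ker_domRestrict,
    ← Submodule.finrank_map_subtype_eq, Submodule.map_comap_subtype]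

/-- The boundaries of chains of one parity are cycles of the other parity. -/
theorem map_bd_le (hq : ∀ n, q' (n + 1) ↔ q n) :
    (chainsWith G q').map bd ≤ chainsWith G q ⊓ LinearMap.ker bd := by
  rintro _ ⟨c, hc, rfl⟩
  exact ⟨bd_mem_chainsWith hq hc, bd_bd c⟩

theorem finrank_cycles_le (hG : AtMostOne G Set.univ) (hq : ∀ n, q' (n + 1) ↔ q n) :
    Module.finrank (ZMod 2) (chainsWith G q ⊓ LinearMap.ker bd : Submodule (ZMod 2) (Chain V)) ≤
      Module.finrank (ZMod 2) ((chainsWith G q').map bd) + 1 := by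
  have hcyc : ∀ z ∈ chainsWith G q ⊓ LinearMap.ker bd, z ∈ cycles G Set.univ :=
    fun z hz => ⟨chainsWith_le hz.1, hz.2⟩
  have hbd : ∀ z ∈ chainsWith G q, z ∈ boundaries G Set.univ → z ∈ (chainsWith G q').map bd := by
    rintro _ hz ⟨c, hc, rfl⟩
    refine ⟨restr q' c, restr_mem_chainsWith hc, ?_⟩
    rw [bd_restr]
    simp only [hq]
    exact restr_eq_self hz
  obtain ⟨z, hz⟩ : ∃ z, chainsWith G q ⊓ LinearMap.ker bd ≤
      (chainsWith G q').map bd ⊔ Submodule.span (ZMod 2) {z} := by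
    by_cases h : chainsWith G q ⊓ LinearMap.ker bd ≤ (chainsWith G q').map bd
    · exact ⟨0, h.trans le_sup_left⟩
    · obtain ⟨z, hz, hzB⟩ := SetLike.not_le_iff_exists.1 h
      refine ⟨z, fun x hx => ?_⟩
      have hzs := Submodule.mem_span_singleton_self (R := ZMod 2) z
      rcases hG z (hcyc z hz) x (hcyc x hx) with h1 | h1 | h1
      · exact absurd (hbd z hz.1 h1) hzB
      · exact Submodule.mem_sup_left (hbd x hx.1 h1)
      · have h2 := hbd _ (add_mem hz.1 hx.1) h1
        exact mem_of_add_mem_left (Submodule.mem_sup_left h2) (Submodule.mem_sup_right hzs)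
  calc _ ≤ _ := Submodule.finrank_mono hz
    _ ≤ _ := Submodule.finrank_add_le_finrank_add_finrank _ _
    _ ≤ _ := by
      gcongr
      exact (finrank_span_le_card _).trans (by simp)

theorem fG_empty_eq : fG G ∅ ∅ = (faces G Even).card - (faces G fun n => ¬ Even n).card := by
  have h : ∀ n : ℕ, (-1 : ℤ) ^ n = (if Even n then 1 else 0) - if ¬ Even n then 1 else 0 := by
    intro n
    by_cases hn : Even n
    · simp [hn]
    · simp [hn, (Nat.not_even_iff_odd.1 hn).neg_one_pow]
  have hp : ∀ p : ℕ → Prop, ((faces G p).card : ℤ) =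
      ∑ A ∈ Finset.univ.filter (fun A : Finset V => Stable G A), if p A.card then 1 else 0 := by
    intro p
    rw [Finset.sum_boole, Finset.filter_filter, faces]
  rw [hp, hp, ← Finset.sum_sub_distrib, fG]
  refine Finset.sum_congr ?_ fun A _ => by convert h _
  ext A
  rw [Finset.mem_filter, Finset.mem_filter]
  simp [Stable]

theorem abs_fG_le_one (hG : AtMostOne G Set.univ) : |fG G ∅ ∅| ≤ 1 := by
  have h1 : ∀ n, ¬ Even (n + 1) ↔ Even n := fun n => by simp [Nat.even_add_one]
  have h2 : ∀ n, Even (n + 1) ↔ ¬ Even n := fun n => Nat.even_add_one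
  have e1 := finrank_cycles_le (q := Even) (q' := fun n => ¬ Even n) hG h1
  have e2 := finrank_cycles_le (q := fun n => ¬ Even n) (q' := Even) hG h2
  have e3 := Submodule.finrank_mono (map_bd_le (G := G) (q := Even) (q' := fun n => ¬ Even n) h1)
  have e4 := Submodule.finrank_mono (map_bd_le (G := G) (q := fun n => ¬ Even n) (q' := Even) h2)
  rw [fG_empty_eq, card_faces, card_faces, abs_le]
  push_cast
  omega

end

end IndependenceComplex

theorem kalai_meshulam (G : SimpleGraph V) (hG : Ternary G) :
    |fG G ∅ ∅| ≤ 1 := by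
  exact IndependenceComplex.abs_fG_le_one (IndependenceComplex.atMostOne_of_ternary hG Set.univ)
end
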